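/- arXiv:1204.2435 — 3 statements merged into one kernel-verified Lean document; each statement's English description precedes it below -/
import Mathlib

section
/- f is strictly increasing on [0,∞): for all 0 ≤ z₁ < z₂ one has f(z₁) < f(z₂); in particular f(z) > 0 for every z > 0. -/
open Finset Filter Real Topology

/-- The local weight enumerating polynomial `A_t(z) = 1 + ∑_{u=r_t}^{s_t} a_{t,u} z^u`,
encoded with a full coefficient function `a` satisfying `a t 0 = 1`, `a t u = 0` for
`0 < u < r t` and for `u > s t`. -/
noncomputable def Afun {ι : Type*} (s : ι → ℕ) (a : ι → ℕ → ℝ) (t : ι) (z : ℝ) : ℝ :=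
  ∑ u ∈ Finset.range (s t + 1), a t u * z ^ u

/-- The function `f(z) = c ⬝ ∑_{t ∈ I_c} γ_t z A_t′(z) / A_t(z)`. -/
noncomputable def ff {ι : Type*} [Fintype ι] (s : ι → ℕ) (a : ι → ℕ → ℝ)
    (γ : ι → ℝ) (c : ℝ) (z : ℝ) : ℝ :=
  c * ∑ t, γ t * (z * deriv (Afun s a t) z) / Afun s a t z

lemma sub_mul_pow_mul_pow_sub_nonneg {x y : ℝ} (hx : 0 ≤ x) (hxy : x ≤ y) (u v : ℕ) :
    0 ≤ ((u : ℝ) - v) * (y ^ u * x ^ v - x ^ u * y ^ v) := by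
  wlog h : v ≤ u generalizing u v
  · linarith [this v u (by omega)]
  obtain ⟨k, rfl⟩ := Nat.exists_eq_add_of_le h
  have hy : 0 ≤ y := hx.trans hxy
  have hk : x ^ k ≤ y ^ k := by gcongr
  have key : (((v + k : ℕ) : ℝ) - v) * (y ^ (v + k) * x ^ v - x ^ (v + k) * y ^ v)
      = k * (x ^ v * y ^ v) * (y ^ k - x ^ k) := by
    push_cast
    ring
  rw [key]
  exact mul_nonneg (by positivity) (sub_nonneg.2 hk)

/-- The cross-multiplied form of strict monotonicity of `z P'(z) / P(z)` for a polynomial `P`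
with nonnegative coefficients, positive constant coefficient and some other positive coefficient. -/
lemma sum_mul_sum_lt_of_coeff_nonneg {b : ℕ → ℝ} (hb : ∀ u, 0 ≤ b u) (h0 : 0 < b 0)
    {n m : ℕ} (hm : m ≠ 0) (hmn : m < n) (hbm : 0 < b m) {x y : ℝ} (hx : 0 ≤ x) (hxy : x < y) :
    (∑ u ∈ range n, u * (b u * x ^ u)) * ∑ v ∈ range n, b v * y ^ v <
      (∑ u ∈ range n, u * (b u * y ^ u)) * ∑ v ∈ range n, b v * x ^ v := by
  have hpos : 0 < ∑ u ∈ range n, ∑ v ∈ range n,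
      b u * b v * (((u : ℝ) - v) * (y ^ u * x ^ v - x ^ u * y ^ v)) := by
    have hterm (u v : ℕ) :
        0 ≤ b u * b v * (((u : ℝ) - v) * (y ^ u * x ^ v - x ^ u * y ^ v)) :=
      mul_nonneg (mul_nonneg (hb u) (hb v)) (sub_mul_pow_mul_pow_sub_nonneg hx hxy.le u v)
    refine sum_pos' (fun u _ ↦ sum_nonneg fun v _ ↦ hterm u v) ⟨m, mem_range.2 hmn, ?_⟩
    refine sum_pos' (fun v _ ↦ hterm m v) ⟨0, mem_range.2 (by omega), ?_⟩
    have hpow : x ^ m < y ^ m := pow_lt_pow_left₀ hxy hx hm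
    have hm' : (0 : ℝ) < m := by exact_mod_cast Nat.pos_of_ne_zero hm
    simpa using mul_pos (mul_pos hbm h0) (mul_pos hm' (sub_pos.2 hpow))
  have hsplit : ∑ u ∈ range n, ∑ v ∈ range n,
      b u * b v * (((u : ℝ) - v) * (y ^ u * x ^ v - x ^ u * y ^ v)) =
      (∑ u ∈ range n, ∑ v ∈ range n,
        (u * (b u * y ^ u) * (b v * x ^ v) - u * (b u * x ^ u) * (b v * y ^ v))) +
      ∑ u ∈ range n, ∑ v ∈ range n,
        (b u * x ^ u * (v * (b v * y ^ v)) - b u * y ^ u * (v * (b v * x ^ v))) := by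
    simp_rw [← sum_add_distrib]
    refine sum_congr rfl fun u _ ↦ sum_congr rfl fun v _ ↦ ?_
    ring
  rw [hsplit] at hpos
  simp_rw [sum_sub_distrib, ← sum_mul_sum] at hpos
  linarith

section Afun

variable {ι : Type*} (s : ι → ℕ) (a : ι → ℕ → ℝ) (t : ι)

lemma mul_deriv_Afun (z : ℝ) :
    z * deriv (Afun s a t) z = ∑ u ∈ range (s t + 1), u * (a t u * z ^ u) := by
  have h : HasDerivAt (Afun s a t)
      (∑ u ∈ range (s t + 1), a t u * (u * z ^ (u - 1))) z :=
    HasDerivAt.fun_sum fun u _ ↦ (hasDerivAt_pow u z).const_mul (a t u)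
  rw [h.deriv, mul_sum]
  refine sum_congr rfl fun u _ ↦ ?_
  rcases u with _ | u
  · simp
  · rw [Nat.add_sub_cancel, pow_succ]
    ring

variable {s a t}

lemma Afun_pos (hnn : ∀ u, 0 ≤ a t u) (h0 : 0 < a t 0) {z : ℝ} (hz : 0 ≤ z) :
    0 < Afun s a t z :=
  sum_pos' (fun u _ ↦ mul_nonneg (hnn u) (pow_nonneg hz u))
    ⟨0, mem_range.2 (Nat.succ_pos _), by simpa using h0⟩

end Afun

/-- `f` is strictly increasing on `[0,∞)`; in particular `f(z) > 0` for `z > 0`. -/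
theorem stmt_1 {ι : Type*} [Fintype ι] [Nonempty ι]
    (r s : ι → ℕ) (h2r : ∀ t, 2 ≤ r t) (hrs : ∀ t, r t ≤ s t)
    (a : ι → ℕ → ℝ)
    (ha0 : ∀ t, a t 0 = 1)
    (hmid : ∀ t u, 0 < u → u < r t → a t u = 0)
    (hhigh : ∀ t u, s t < u → a t u = 0)
    (hnn : ∀ t u, 0 ≤ a t u)
    (har : ∀ t, 0 < a t (r t))
    (γ : ι → ℝ) (hγ : ∀ t, 0 < γ t) (c : ℝ) (hc : 0 < c) :
    (∀ z₁ z₂ : ℝ, 0 ≤ z₁ → z₁ < z₂ → ff s a γ c z₁ < ff s a γ c z₂) ∧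
    (∀ z : ℝ, 0 < z → 0 < ff s a γ c z) := by
  have hmono : ∀ z₁ z₂ : ℝ, 0 ≤ z₁ → z₁ < z₂ → ff s a γ c z₁ < ff s a γ c z₂ := by
    intro x y hx hxy
    refine mul_lt_mul_of_pos_left (sum_lt_sum_of_nonempty univ_nonempty fun t _ ↦ ?_) hc
    have h0 : 0 < a t 0 := by simp [ha0]
    have hr : r t ≠ 0 := by have := h2r t; omega
    rw [mul_div_assoc (γ t), mul_div_assoc (γ t)]
    refine mul_lt_mul_of_pos_left ?_ (hγ t)
    rw [div_lt_div_iff₀ (Afun_pos (hnn t) h0 hx) (Afun_pos (hnn t) h0 (hx.trans hxy.le)),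
      mul_deriv_Afun, mul_deriv_Afun]
    exact sum_mul_sum_lt_of_coeff_nonneg (hnn t) h0 hr (Nat.lt_succ_of_le (hrs t)) (har t) hx hxy
  refine ⟨hmono, fun z hz ↦ ?_⟩
  simpa [ff] using hmono 0 z le_rfl hz
end

section
/- Let ξ = p/q′ with p, q′ positive integers and 0 < ξ < d̄, and let z be the unique positive real satisfying z A′(z)/A(z) = ξ. Then, as m → ∞ along integers m for which the coefficient of x^{pm} in A(x)^{q′m} is nonzero (there are infinitely many such m), one has (1/(q′m)) · log(coefficient of x^{pm} in A(x)^{q′m}) → log A(z) − ξ log z. -/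
open Finset Filter Real Topology Polynomial

/-- A Fekete-type lemma for supermultiplicative nonnegative sequences, along the indices where the
sequence does not vanish. -/
theorem tendsto_log_div_of_supermultiplicative (u : ℕ → ℝ) (hu : ∀ i, 0 ≤ u i)
    (hmul : ∀ i j, u i * u j ≤ u (i + j)) (M : ℝ)
    (hupper : ∀ m, 0 < u m → log (u m) ≤ m * M)
    (hlower : ∀ ε > 0, ∃ m : ℕ, 0 < m ∧ 0 < u m ∧ m * (M - ε) ≤ log (u m)) :
    Tendsto (fun m : ℕ => log (u m) / m) (atTop ⊓ 𝓟 {m : ℕ | u m ≠ 0}) (𝓝 M) := by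
  classical
  rw [Metric.tendsto_nhds]
  intro ε hε
  obtain ⟨m₀, hm₀, hum₀, hlog₀⟩ := hlower (ε / 3) (by positivity)
  have hpow : ∀ t k, u t * u m₀ ^ k ≤ u (t + k * m₀) := by
    intro t k
    induction k with
    | zero => simp
    | succ k ih =>
      calc u t * u m₀ ^ (k + 1) = (u t * u m₀ ^ k) * u m₀ := by ring
        _ ≤ u (t + k * m₀) * u m₀ := by gcongr
        _ ≤ u (t + k * m₀ + m₀) := hmul _ _
        _ = u (t + (k + 1) * m₀) := by congr 1; ring
  have hrep : ∀ r, ∃ t, (∃ s, 0 < u s ∧ s % m₀ = r) → 0 < u t ∧ t % m₀ = r := by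
    intro r
    by_cases h : ∃ s, 0 < u s ∧ s % m₀ = r
    · exact ⟨h.choose, fun _ => h.choose_spec⟩
    · exact ⟨0, fun h' => absurd h' h⟩
  choose t ht using hrep
  set B : ℝ := ∑ r ∈ range m₀, |log (u (t r)) - t r * (M - ε / 3)| with hB
  rw [eventually_inf_principal]
  filter_upwards [eventually_ge_atTop (∑ r ∈ range m₀, t r), eventually_gt_atTop 0,
    eventually_ge_atTop ⌈B / (ε / 3)⌉₊] with m hmT hm0 hmB hne
  have hum : 0 < u m := lt_of_le_of_ne (hu m) (Ne.symm hne)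
  have hr : m % m₀ ∈ range m₀ := mem_range.2 (Nat.mod_lt _ hm₀)
  obtain ⟨hut, htm⟩ := ht (m % m₀) ⟨m, hum, rfl⟩
  have htle : t (m % m₀) ≤ m :=
    (single_le_sum (f := t) (fun _ _ => Nat.zero_le _) hr).trans hmT
  have hBr : |log (u (t (m % m₀))) - t (m % m₀) * (M - ε / 3)| ≤ B :=
    single_le_sum (f := fun r => |log (u (t r)) - t r * (M - ε / 3)|)
      (fun _ _ => abs_nonneg _) hr
  generalize t (m % m₀) = s at *
  obtain ⟨k, hk⟩ : ∃ k, m = s + k * m₀ := by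
    obtain ⟨k, hk⟩ := (Nat.modEq_iff_dvd' htle).1 htm
    exact ⟨k, by rw [mul_comm, ← hk]; omega⟩
  have h1 : log (u s) + k * log (u m₀) ≤ log (u m) := by
    rw [← log_pow, ← log_mul hut.ne' (pow_pos hum₀ k).ne', hk]
    exact log_le_log (by positivity) (hpow s k)
  have hmR : (0 : ℝ) < m := by exact_mod_cast hm0
  have h2 : B ≤ m * (ε / 3) := by
    have := (Nat.le_ceil _).trans (Nat.cast_le (α := ℝ).2 hmB)
    rwa [div_le_iff₀ (by positivity)] at this
  have hkR : (m : ℝ) = s + k * m₀ := by exact_mod_cast hk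
  have h3 := mul_le_mul_of_nonneg_left hlog₀ (Nat.cast_nonneg (α := ℝ) k)
  have h4 := (abs_le.1 hBr).1
  have h5 : m * (M - 2 * (ε / 3)) ≤ log (u m) := by
    have : (m : ℝ) * (M - ε / 3) = s * (M - ε / 3) + k * (m₀ * (M - ε / 3)) := by
      rw [hkR]; ring
    linarith
  have h6 := hupper m hum
  rw [Real.dist_eq, abs_lt]
  constructor
  · rw [lt_sub_iff_add_lt, lt_div_iff₀ hmR]
    nlinarith
  · rw [sub_lt_iff_lt_add, div_lt_iff₀ hmR]
    nlinarith

namespace Polynomial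

theorem coeff_mul_nonneg {P Q : ℝ[X]} (hP : ∀ i, 0 ≤ P.coeff i) (hQ : ∀ i, 0 ≤ Q.coeff i)
    (n : ℕ) : 0 ≤ (P * Q).coeff n := by
  rw [coeff_mul]
  exact sum_nonneg fun x _ => mul_nonneg (hP _) (hQ _)

theorem coeff_pow_nonneg {P : ℝ[X]} (hP : ∀ i, 0 ≤ P.coeff i) (k n : ℕ) :
    0 ≤ (P ^ k).coeff n := by
  induction k generalizing n with
  | zero => rw [pow_zero, coeff_one]; split_ifs <;> simp
  | succ k ih => rw [pow_succ]; exact coeff_mul_nonneg ih hP n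

theorem coeff_mul_coeff_le {P Q : ℝ[X]} (hP : ∀ i, 0 ≤ P.coeff i) (hQ : ∀ i, 0 ≤ Q.coeff i)
    (i j : ℕ) : P.coeff i * Q.coeff j ≤ (P * Q).coeff (i + j) := by
  rw [coeff_mul]
  exact single_le_sum (f := fun x : ℕ × ℕ => P.coeff x.1 * Q.coeff x.2)
    (fun x _ => mul_nonneg (hP _) (hQ _)) (mem_antidiagonal.2 (rfl : (i, j).1 + (i, j).2 = i + j))

theorem pow_coeff_le_coeff_pow {P : ℝ[X]} (hP : ∀ i, 0 ≤ P.coeff i) (j k : ℕ) :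
    P.coeff j ^ k ≤ (P ^ k).coeff (k * j) := by
  induction k with
  | zero => simp
  | succ k ih =>
    rw [pow_succ, pow_succ, Nat.succ_mul]
    exact (mul_le_mul_of_nonneg_right ih (hP j)).trans
      (coeff_mul_coeff_le (coeff_pow_nonneg hP k) hP _ _)

theorem coeff_mul_pow_le_eval {P : ℝ[X]} (hP : ∀ i, 0 ≤ P.coeff i) {z : ℝ} (hz : 0 ≤ z) (n : ℕ) :
    P.coeff n * z ^ n ≤ P.eval z := by
  rw [eval_eq_sum_range' (n := max (P.natDegree + 1) (n + 1)) (by omega)]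
  exact single_le_sum (f := fun i => P.coeff i * z ^ i)
    (fun i _ => mul_nonneg (hP i) (pow_nonneg hz i)) (mem_range.2 (by omega))

theorem coeff_X_mul_derivative (P : ℝ[X]) (j : ℕ) :
    (X * derivative P).coeff j = j * P.coeff j := by
  cases j with
  | zero => simp
  | succ j => rw [coeff_X_mul, coeff_derivative]; push_cast; ring

theorem natDegree_X_mul_derivative_le (P : ℝ[X]) :
    (X * derivative P).natDegree ≤ P.natDegree := by
  rw [natDegree_le_iff_coeff_eq_zero]
  intro N hN
  rw [coeff_X_mul_derivative, coeff_eq_zero_of_natDegree_lt hN, mul_zero]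

theorem sum_coeff_mul_pow_mul_sub_sq (P : ℝ[X]) (z t : ℝ) {n : ℕ} (hn : P.natDegree < n) :
    ∑ j ∈ range n, P.coeff j * z ^ j * ((j : ℝ) - t) ^ 2 =
      (X * derivative (X * derivative P)).eval z - 2 * t * (X * derivative P).eval z
        + t ^ 2 * P.eval z := by
  have h1 := natDegree_X_mul_derivative_le P
  have h2 := natDegree_X_mul_derivative_le (X * derivative P)
  rw [eval_eq_sum_range' hn, eval_eq_sum_range' (h1.trans_lt hn),
    eval_eq_sum_range' ((h2.trans h1).trans_lt hn), mul_sum, mul_sum, ← sum_sub_distrib,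
    ← sum_add_distrib]
  refine sum_congr rfl fun j _ => ?_
  simp only [coeff_X_mul_derivative]
  ring

/-- First and second moments of the coefficients of `A ^ N`. -/
theorem eval_X_mul_derivative_pow (A : ℝ[X]) {z ξ σ : ℝ}
    (h1 : (X * derivative A).eval z = ξ * A.eval z)
    (h2 : (X * derivative (X * derivative A)).eval z = (ξ ^ 2 + σ) * A.eval z) (N : ℕ) :
    (X * derivative (A ^ N)).eval z = N * ξ * A.eval z ^ N ∧
      (X * derivative (X * derivative (A ^ N))).eval z =
        (N ^ 2 * ξ ^ 2 + N * σ) * A.eval z ^ N := by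
  induction N with
  | zero => simp
  | succ N ih =>
    obtain ⟨ih1, ih2⟩ := ih
    have e1 : X * derivative (A ^ (N + 1)) =
        (X * derivative (A ^ N)) * A + A ^ N * (X * derivative A) := by
      rw [pow_succ, derivative_mul]; ring
    have e2 : X * derivative (X * derivative (A ^ (N + 1))) =
        (X * derivative (X * derivative (A ^ N))) * A
          + 2 * ((X * derivative (A ^ N)) * (X * derivative A))
          + A ^ N * (X * derivative (X * derivative A)) := by
      rw [e1, derivative_add, derivative_mul, derivative_mul (f := A ^ N)]; ring
    rw [e2, e1]
    simp only [eval_add, eval_mul (p := X * derivative (A ^ N)), eval_mul (q := A),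
      eval_mul (p := A ^ N), eval_mul (p := (2 : ℝ[X])), eval_pow, ih1, ih2, h1, h2, eval_ofNat]
    push_cast
    constructor <;> ring

/-- Chebyshev's inequality and pigeonhole: some term of `A(z) ^ N` with index close to the mean is
not too small. -/
theorem exists_eval_pow_le_coeff_pow {A : ℝ[X]} (hA : ∀ i, 0 ≤ A.coeff i) {z ξ σ : ℝ} (hz : 0 < z)
    (hpos : 0 < A.eval z)
    (h1 : (X * derivative A).eval z = ξ * A.eval z)
    (h2 : (X * derivative (X * derivative A)).eval z = (ξ ^ 2 + σ) * A.eval z)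
    (N : ℕ) {R : ℝ} (hR : 0 < R) (hNR : 2 * (N * σ) ≤ R ^ 2) :
    ∃ j : ℕ, |(j : ℝ) - N * ξ| ≤ R ∧
      A.eval z ^ N ≤ 2 * (N * A.natDegree + 1) * ((A ^ N).coeff j * z ^ j) := by
  by_contra! hcon
  set D : ℝ := N * A.natDegree + 1 with hD
  have hDpos : 0 < D := by positivity
  have hdeg : (A ^ N).natDegree < N * A.natDegree + 1 := Nat.lt_succ_of_le natDegree_pow_le
  obtain ⟨m1, m2⟩ := eval_X_mul_derivative_pow A h1 h2 N
  have hvar := sum_coeff_mul_pow_mul_sub_sq (A ^ N) z (N * ξ) hdeg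
  have htot := eval_eq_sum_range' hdeg z
  rw [m1, m2, eval_pow] at hvar
  rw [eval_pow] at htot
  set a := A.eval z ^ N with ha
  have hapos : 0 < a := pow_pos hpos N
  have hlt : ∑ j ∈ range (N * A.natDegree + 1), (A ^ N).coeff j * z ^ j <
      ∑ j ∈ range (N * A.natDegree + 1),
        (a / (2 * D) + (A ^ N).coeff j * z ^ j * ((j : ℝ) - N * ξ) ^ 2 / R ^ 2) := by
    refine sum_lt_sum_of_nonempty (by simp) fun j _ => ?_
    have hc : 0 ≤ (A ^ N).coeff j * z ^ j :=
      mul_nonneg (coeff_pow_nonneg hA N j) (pow_nonneg hz.le j)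
    rcases le_or_gt |(j : ℝ) - N * ξ| R with h | h
    · have h3 : (A ^ N).coeff j * z ^ j < a / (2 * D) := by
        rw [lt_div_iff₀ (by positivity), mul_comm]
        exact hcon j h
      have : 0 ≤ (A ^ N).coeff j * z ^ j * ((j : ℝ) - N * ξ) ^ 2 / R ^ 2 := by positivity
      linarith
    · have h3 : R ^ 2 ≤ ((j : ℝ) - N * ξ) ^ 2 := by
        rw [← sq_abs ((j : ℝ) - N * ξ)]
        gcongr
      have h4 : (A ^ N).coeff j * z ^ j ≤
          (A ^ N).coeff j * z ^ j * ((j : ℝ) - N * ξ) ^ 2 / R ^ 2 := by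
        rw [le_div_iff₀ (by positivity)]
        gcongr
      have : 0 < a / (2 * D) := by positivity
      linarith
  rw [sum_add_distrib, sum_const, ← sum_div, hvar, ← htot, card_range, nsmul_eq_mul] at hlt
  have e1 : ((N * A.natDegree + 1 : ℕ) : ℝ) * (a / (2 * D)) = a / 2 := by
    push_cast
    rw [← hD]
    field_simp
  have e2 : ((N ^ 2 * ξ ^ 2 + N * σ) * a - 2 * (N * ξ) * (N * ξ * a) + (N * ξ) ^ 2 * a) / R ^ 2
      ≤ a / 2 := by
    rw [div_le_iff₀ (by positivity)]
    nlinarith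
  rw [e1] at hlt
  linarith

/-- Spreading a coefficient `j` of `A ^ (q * m)` with `|j - p * m| ≤ M` to the coefficient of
index `p * n` of `A ^ (q * n)`, where `n = D * (m + M)`, with factors `1` and `x ^ D`. -/
theorem coeff_pow_mul_le_coeff {A : ℝ[X]} (hA : ∀ i, 0 ≤ A.coeff i) (h0 : A.coeff 0 = 1)
    {D p q m M j : ℕ} {β : ℝ} (hβ0 : 0 ≤ β) (hβ1 : β ≤ 1) (hβ : β ≤ A.coeff D)
    (hp : 0 < p) (hpq : p < q * D) (hj1 : j ≤ p * m + M) (hj2 : p * m ≤ j + M) :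
    (A ^ (q * m)).coeff j ^ D * β ^ (q * D * M) ≤
      (A ^ (q * (D * (m + M)))).coeff (p * (D * (m + M))) := by
  have hM1 : M ≤ p * M := Nat.le_mul_of_pos_left M hp
  have hM2 : p * M + M ≤ q * D * M := by nlinarith
  obtain ⟨k, hk⟩ : ∃ k, p * m + p * M = j + k := ⟨p * m + p * M - j, by omega⟩
  have hkM : k ≤ q * D * M := by omega
  obtain ⟨l, hl⟩ := Nat.exists_eq_add_of_le hkM
  have hpow1 := pow_coeff_le_coeff_pow hA D k
  have hpow2 := pow_coeff_le_coeff_pow hA 0 l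
  have h1 := coeff_mul_coeff_le (coeff_pow_nonneg hA k) (coeff_pow_nonneg hA l) (k * D) (l * 0)
  have h2 := pow_coeff_le_coeff_pow (coeff_pow_nonneg hA (q * m)) j D
  have h3 := coeff_mul_coeff_le (coeff_pow_nonneg (coeff_pow_nonneg hA (q * m)) D)
    (coeff_pow_nonneg hA (q * D * M)) (D * j) (k * D)
  rw [← pow_add, ← hl, mul_zero, add_zero] at h1
  rw [h0, one_pow, mul_zero] at hpow2
  have h4 : β ^ (q * D * M) ≤ (A ^ (q * D * M)).coeff (k * D) :=
    calc β ^ (q * D * M) ≤ β ^ k := pow_le_pow_of_le_one hβ0 hβ1 hkM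
      _ ≤ A.coeff D ^ k := by gcongr
      _ ≤ (A ^ k).coeff (k * D) := hpow1
      _ ≤ (A ^ k).coeff (k * D) * (A ^ l).coeff 0 :=
        le_mul_of_one_le_right (coeff_pow_nonneg hA _ _) hpow2
      _ ≤ _ := by simpa using h1
  have e1 : (A ^ (q * m)) ^ D * A ^ (q * D * M) = A ^ (q * (D * (m + M))) := by
    rw [← pow_mul, ← pow_add]; congr 1; ring
  have e2 : D * j + k * D = p * (D * (m + M)) := by
    calc D * j + k * D = D * (j + k) := by ring
      _ = _ := by rw [← hk]; ring
  rw [e1, e2] at h3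
  refine le_trans ?_ h3
  exact mul_le_mul h2 h4 (pow_nonneg hβ0 _)
    (coeff_pow_nonneg (coeff_pow_nonneg hA (q * m)) D (D * j))

end Polynomial

theorem log_mul_pow_three_le {F K : ℝ} (hF : 2 ≤ F) (hK : 1 ≤ K) :
    log (F * K ^ 3) ≤ F * K ^ 2 := by
  have hF0 : 0 < F := by linarith
  have hK0 : 0 < K := by linarith
  rw [log_mul hF0.ne' (pow_pos hK0 3).ne', log_pow]
  have h1 := log_le_sub_one_of_pos hF0
  have h2 := log_le_sub_one_of_pos hK0
  have h3 : 0 ≤ (F - 2) * (K ^ 2 - 1) := mul_nonneg (by linarith) (by nlinarith)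
  push_cast
  nlinarith [sq_nonneg (K - 1)]

/-- The value `q * log A(z) - p * log z` is approached by the normalized logarithms of the
coefficients of index `p * m` of `A ^ (q * m)`. -/
theorem exists_le_log_coeff {A : ℝ[X]} (hA : ∀ i, 0 ≤ A.coeff i) (h0 : A.coeff 0 = 1)
    {D p q : ℕ} (hD : 0 < A.coeff D) (hp : 0 < p) (hpq : p < q * D) {z : ℝ} (hz : 0 < z)
    (hpos : 0 < A.eval z)
    (hmean : q * (X * derivative A).eval z = p * A.eval z) {ε : ℝ} (hε : 0 < ε) :
    ∃ m : ℕ, 0 < m ∧ 0 < (A ^ (q * m)).coeff (p * m) ∧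
      m * (q * log (A.eval z) - p * log z - ε) ≤ log ((A ^ (q * m)).coeff (p * m)) := by
  have hq : 0 < q := Nat.pos_of_mul_pos_right (by omega : 0 < q * D)
  have hD0 : 0 < D := Nat.pos_of_mul_pos_left (by omega : 0 < q * D)
  have hqR : (0 : ℝ) < q := by exact_mod_cast hq
  set a := A.eval z with ha
  set ξ : ℝ := p / q with hξ
  set σ : ℝ := (X * derivative (X * derivative A)).eval z / a - ξ ^ 2 with hσ
  have h1 : (X * derivative A).eval z = ξ * a := by
    rw [hξ]; field_simp; linarith
  have h2 : (X * derivative (X * derivative A)).eval z = (ξ ^ 2 + σ) * a := by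
    rw [hσ]; field_simp; ring
  set β : ℝ := min 1 (A.coeff D) with hβ
  have hβ0 : 0 < β := lt_min one_pos hD
  set g : ℝ := q * log a - p * log z with hg
  set C : ℝ := |log z| + 2 * (q * A.natDegree + 1) - q * log β + |g| with hC
  obtain ⟨K, hK⟩ := exists_nat_gt (max 1 (max (2 * q * σ) (C / ε)))
  have hK1 : (1 : ℝ) < K := (le_max_left _ _).trans_lt hK
  have hK2 : 2 * q * σ < K := ((le_max_left _ _).trans (le_max_right _ _)).trans_lt hK
  have hK3 : C < K * ε := by
    have := ((le_max_right _ _).trans (le_max_right _ _)).trans_lt hK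
    rwa [div_lt_iff₀ hε] at this
  have hK0 : 0 < K := by
    have : (0 : ℝ) < K := by linarith
    exact_mod_cast this
  obtain ⟨j, hj, hcj⟩ := exists_eval_pow_le_coeff_pow hA hz hpos h1 h2 (q * K ^ 3)
    (R := (K ^ 2 : ℕ)) (by positivity) (by
      push_cast
      have := mul_le_mul_of_nonneg_right hK2.le (by positivity : (0 : ℝ) ≤ (K : ℝ) ^ 3)
      linarith only [this])
  have hmid : ((q * K ^ 3 : ℕ) : ℝ) * ξ = (p * K ^ 3 : ℕ) := by
    rw [hξ]; push_cast; field_simp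
  rw [hmid, abs_le] at hj
  have hj1 : j ≤ p * K ^ 3 + K ^ 2 := by
    have : (j : ℝ) ≤ ((p * K ^ 3 + K ^ 2 : ℕ) : ℝ) := by rw [Nat.cast_add]; linarith [hj.2]
    exact_mod_cast this
  have hj2 : p * K ^ 3 ≤ j + K ^ 2 := by
    have : ((p * K ^ 3 : ℕ) : ℝ) ≤ ((j + K ^ 2 : ℕ) : ℝ) := by rw [Nat.cast_add]; linarith [hj.1]
    exact_mod_cast this
  have hle := coeff_pow_mul_le_coeff hA h0 hβ0.le (min_le_left _ _) (min_le_right _ _)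
    hp hpq hj1 hj2
  set c := (A ^ (q * K ^ 3)).coeff j with hc
  set E : ℝ := 2 * ((q * K ^ 3 : ℕ) * A.natDegree + 1) with hE
  have hEpos : 0 < E := by positivity
  have hcpos : 0 < c := by
    have : 0 < E * (c * z ^ j) := (pow_pos hpos _).trans_le hcj
    have h := pos_of_mul_pos_right this hEpos.le
    exact pos_of_mul_pos_left h (by positivity)
  have hprod : 0 < c ^ D * β ^ (q * D * K ^ 2) := by positivity
  refine ⟨D * (K ^ 3 + K ^ 2), by positivity, hprod.trans_le hle, ?_⟩
  refine le_trans ?_ (log_le_log hprod hle)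
  rw [log_mul (by positivity) (by positivity), log_pow, log_pow]
  have hlogc : (q * K ^ 3 : ℕ) * log a ≤ log E + (log c + j * log z) := by
    rw [← log_pow, ← log_pow, ← log_mul (by positivity) (by positivity),
      ← log_mul (by positivity) (by positivity)]
    exact log_le_log (by positivity) hcj
  have hlogE : log E ≤ 2 * (q * A.natDegree + 1) * K ^ 2 := by
    have hE1 : E ≤ 2 * (q * A.natDegree + 1) * (K : ℝ) ^ 3 := by
      rw [hE]; push_cast
      have : (1 : ℝ) ≤ (K : ℝ) ^ 3 := one_le_pow₀ hK1.le
      linarith only [this]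
    have hF : (2 : ℝ) ≤ 2 * (q * A.natDegree + 1) := by
      have : (0 : ℝ) ≤ q * A.natDegree := by positivity
      linarith only [this]
    exact (log_le_log hEpos hE1).trans (log_mul_pow_three_le hF hK1.le)
  have hjz : j * log z ≤ (p * K ^ 3 : ℕ) * log z + K ^ 2 * |log z| := by
    have h3 : |(j : ℝ) - (p * K ^ 3 : ℕ)| ≤ (K ^ 2 : ℕ) := abs_le.2 hj
    have h4 := mul_le_mul_of_nonneg_right h3 (abs_nonneg (log z))
    rw [← abs_mul] at h4
    have h5 := (le_abs_self _).trans h4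
    push_cast at h5 ⊢
    linarith
  have hKg : (K : ℝ) ^ 2 * g ≤ (K : ℝ) ^ 2 * |g| := by gcongr; exact le_abs_self g
  have hKC : (K : ℝ) ^ 2 * C ≤ (K ^ 3 + K ^ 2) * ε := by
    have := mul_le_mul_of_nonneg_left hK3.le (by positivity : (0 : ℝ) ≤ (K : ℝ) ^ 2)
    have h3 : 0 ≤ (K : ℝ) ^ 2 * ε := by positivity
    linarith only [this, h3]
  have key : ((K : ℝ) ^ 3 + K ^ 2) * (g - ε) ≤ log c + q * K ^ 2 * log β := by
    have hg' : (K : ℝ) ^ 3 * g = q * K ^ 3 * log a - p * K ^ 3 * log z := by rw [hg]; ring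
    rw [hC] at hKC
    push_cast at hlogc hjz
    linarith only [hg', hKC, hlogc, hjz, hKg, hlogE]
  have := mul_le_mul_of_nonneg_left key (Nat.cast_nonneg (α := ℝ) D)
  push_cast
  linarith only [this]

/-- one-dimensional Hayman-type coefficient asymptotics.  With
`A(x) = 1 + ∑_{u=c}^{d} A_u x^u`, `ξ = p/q′ ∈ (0, d̄)` and `z > 0` the positive real with
`z A′(z)/A(z) = ξ`, the set of `m` with nonzero coefficient of `x^{pm}` in `A(x)^{q′m}` is
infinite, and along those `m`,
`(1/(q′m)) log Coeff[A^{q′m}, x^{pm}] → log A(z) − ξ log z`. -/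
theorem stmt_12 (c d : ℕ) (hc : 1 ≤ c) (hcd : c ≤ d)
    (A : Polynomial ℝ)
    (h0 : A.coeff 0 = 1)
    (hnn : ∀ u, 0 ≤ A.coeff u)
    (hlow : ∀ u, 0 < u → u < c → A.coeff u = 0)
    (hhigh : ∀ u, d < u → A.coeff u = 0)
    (hac : 0 < A.coeff c)
    (dbar : ℕ) (hdbar_pos : 0 < A.coeff dbar)
    (hdbar_max : ∀ u, A.coeff u ≠ 0 → u ≤ dbar)
    (p q' : ℕ) (hp : 0 < p) (hq' : 0 < q')
    (ξ : ℝ) (hξ : ξ = (p : ℝ) / q') (hξpos : 0 < ξ) (hξd : ξ < (dbar : ℝ))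
    (z : ℝ) (hz : 0 < z)
    (hzeq : z * (Polynomial.derivative A).eval z / A.eval z = ξ) :
    {m : ℕ | (A ^ (q' * m)).coeff (p * m) ≠ 0}.Infinite ∧
    Filter.Tendsto
      (fun m : ℕ => (1 / ((q' : ℝ) * m)) * Real.log ((A ^ (q' * m)).coeff (p * m)))
      (Filter.atTop ⊓ Filter.principal {m : ℕ | (A ^ (q' * m)).coeff (p * m) ≠ 0})
      (𝓝 (Real.log (A.eval z) - ξ * Real.log z)) := by
  have hqR : (0 : ℝ) < q' := by exact_mod_cast hq'
  have hone : 1 ≤ A.eval z := by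
    have := coeff_mul_pow_le_eval hnn hz.le 0
    rwa [h0, pow_zero, one_mul] at this
  have hpos : 0 < A.eval z := by linarith
  have hmean : q' * (X * derivative A).eval z = p * A.eval z := by
    rw [hξ, div_eq_div_iff hpos.ne' hqR.ne'] at hzeq
    rw [eval_mul, eval_X, ← hzeq]
    ring
  have hpq : p < q' * dbar := by
    rw [hξ, div_lt_iff₀ hqR] at hξd
    rw [mul_comm]
    exact_mod_cast hξd
  have hlower := fun ε (hε : (0 : ℝ) < ε) =>
    exists_le_log_coeff hnn h0 hdbar_pos hp hpq hz hpos hmean hε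
  constructor
  · obtain ⟨m, hm, hcm, -⟩ := hlower 1 one_pos
    refine Set.infinite_of_injective_forall_mem (f := fun k : ℕ => m * k)
      (fun _ _ h => Nat.eq_of_mul_eq_mul_left hm h) fun k => ?_
    have h := pow_coeff_le_coeff_pow (coeff_pow_nonneg hnn (q' * m)) (p * m) k
    rw [← pow_mul, mul_assoc, mul_comm k, mul_assoc] at h
    exact ((pow_pos hcm k).trans_le h).ne'
  · have hlim := tendsto_log_div_of_supermultiplicative
      (fun m => (A ^ (q' * m)).coeff (p * m)) (fun m => coeff_pow_nonneg hnn _ _)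
      (fun i j => by
        have h := coeff_mul_coeff_le (coeff_pow_nonneg hnn (q' * i))
          (coeff_pow_nonneg hnn (q' * j)) (p * i) (p * j)
        rwa [← pow_add, ← mul_add, ← mul_add] at h)
      (q' * log (A.eval z) - p * log z)
      (fun m hm => by
        have h := log_le_log (by positivity)
          (coeff_mul_pow_le_eval (coeff_pow_nonneg hnn (q' * m)) hz.le (p * m))
        rw [log_mul hm.ne' (by positivity), eval_pow, log_pow, log_pow] at h
        push_cast at h
        linarith)
      hlower
    have hlim' := hlim.const_mul (1 / (q' : ℝ))
    convert hlim' using 1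
    · ext m
      rw [div_mul_div_comm, one_mul, one_div_mul_eq_div]
    · rw [hξ]
      congr 1
      field_simp
end

section
/- Suppose ε₀ > 0 and x₀, y₀, z₀, β : (0, ε₀) → (0,∞) are functions such that β(α)∫λ < 1 and the saddle-point system (E1)–(E4) holds at (α; x₀(α), y₀(α), z₀(α), β(α)) for every α ∈ (0, ε₀), and define G(α) = Σ_{t∈I_v} δ_t log B_t(x₀(α),y₀(α)) − α log x₀(α) + (∫ρ/∫λ) Σ_{t∈I_c} γ_t log A_t(z₀(α)) + log(1 − β(α)∫λ)/∫λ. Then lim_{α→0⁺} (G(α) − (T/ψ) α log α)/α = −log x₁ − (T/ψ) log Q₂(x₁). Equivalently, G(α) = (T/ψ) α log α + α [log(1/x₁) + (T/ψ) log(1/Q₂(x₁))] + o(α) as α → 0⁺. -/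
open Finset Filter Real Topology
open scoped Classical

/-- The CN weight enumerating polynomial `A_t(z) = 1 + ∑_{u=r_t}^{s_t} a_{t,u} z^u`. -/
noncomputable def AIcc {ι : Type*} (r s : ι → ℕ) (a : ι → ℕ → ℝ) (t : ι) (z : ℝ) : ℝ :=
  1 + ∑ u ∈ Finset.Icc (r t) (s t), a t u * z ^ u

/-- The VN input–output weight enumerating polynomial
`B_t(x,y) = 1 + ∑_{u=1}^{k_t} ∑_{v=p_t}^{q_t} b_{t,u,v} x^u y^v`. -/
noncomputable def BIcc {ι : Type*} (k p q : ι → ℕ) (b : ι → ℕ → ℕ → ℝ) (t : ι)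
    (x y : ℝ) : ℝ :=
  1 + ∑ u ∈ Finset.Icc 1 (k t), ∑ v ∈ Finset.Icc (p t) (q t), b t u v * x ^ u * y ^ v

/-- `∫ρ = ∑_t ρ_t/s_t` (and likewise `∫λ`). -/
noncomputable def intden {ι : Type*} [Fintype ι] (w : ι → ℝ) (n : ι → ℕ) : ℝ :=
  ∑ t, w t / n t

/-- `γ_t = ρ_t/(s_t ∫ρ)` (and likewise `δ_t = λ_t/(q_t ∫λ)`). -/
noncomputable def nodefrac {ι : Type*} [Fintype ι] (w : ι → ℝ) (n : ι → ℕ) (t : ι) : ℝ :=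
  w t / (n t * intden w n)

/-- `ψ = r/(r−1)`. -/
noncomputable def psiDef (r : ℕ) : ℝ := r / ((r : ℝ) - 1)

/-- `C = r ∑_{t : r_t = r} ρ_t a_{t,r} / s_t`, where `r = min_t r_t`. -/
noncomputable def Cdef {ι : Type*} [Fintype ι] (rc sc : ι → ℕ) (a : ι → ℕ → ℝ)
    (ρ : ι → ℝ) (rmin : ℕ) : ℝ :=
  rmin * ∑ t ∈ Finset.univ.filter (fun t => rc t = rmin), ρ t * a t rmin / sc t

/-- The polynomials `Q₁` (with `wt i j = j`) and `Q₂` (with `wt i j = i`):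
`Q(x) = ∑_{t ∈ Y_v} (λ_t/q_t) ∑_{(i,j) ∈ P_t} wt(i,j) b_{t,i,j} C^{j/r} (∫λ/e)^{iT/ψ} x^i`,
the sum running over the pairs `(i,j)` with `b_{t,i,j} ≠ 0` attaining the minimum `T`
of `(j−ψ)/i`. -/
noncomputable def Qdef {ι : Type*} [Fintype ι] (kv pv qv : ι → ℕ) (b : ι → ℕ → ℕ → ℝ)
    (lam : ι → ℝ) (rmin : ℕ) (T Cv intL : ℝ) (wt : ℕ → ℕ → ℝ) (x : ℝ) : ℝ :=
  ∑ t, (lam t / qv t) *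
    ∑ i ∈ Finset.Icc 1 (kv t), ∑ j ∈ Finset.Icc (pv t) (qv t),
      if b t i j ≠ 0 ∧ ((j : ℝ) - psiDef rmin) / i = T then
        wt i j * b t i j * Cv ^ ((j : ℝ) / rmin) *
          (intL / Real.exp 1) ^ ((i : ℝ) * T / psiDef rmin) * x ^ i
      else 0

/-- The weighted sum `∑ wt(i,j) b_{i,j} x^i y^j` over the support box of one variable node type. -/
noncomputable def vnSum (k p q : ℕ) (b wt : ℕ → ℕ → ℝ) (x y : ℝ) : ℝ :=
  ∑ i ∈ Finset.Icc 1 k, ∑ j ∈ Finset.Icc p q, wt i j * (b i j * x ^ i * y ^ j)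

/-- The weighted sum `∑ wt(u) a_u z^u` over the support range of one check node type. -/
noncomputable def cnSum (r s : ℕ) (a wt : ℕ → ℝ) (z : ℝ) : ℝ :=
  ∑ u ∈ Finset.Icc r s, wt u * (a u * z ^ u)

/-- The part of `vnSum` on which `(j - ψ) / i = T`. -/
noncomputable def tightSum (k p q : ℕ) (b : ℕ → ℕ → ℝ) (ψ T : ℝ) (wt : ℕ → ℕ → ℝ)
    (v u : ℝ) : ℝ :=
  ∑ i ∈ Finset.Icc 1 k, ∑ j ∈ Finset.Icc p q,
    if b i j ≠ 0 ∧ ((j : ℝ) - ψ) / i = T then wt i j * (b i j * u ^ i * v ^ j) else 0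

lemma AIcc_eq_one_add_cnSum {ι : Type*} (r s : ι → ℕ) (a : ι → ℕ → ℝ) (t : ι) (z : ℝ) :
    AIcc r s a t z = 1 + cnSum (r t) (s t) (a t) (fun _ => 1) z := by
  simp [AIcc, cnSum]

lemma BIcc_eq_one_add_vnSum {ι : Type*} (k p q : ι → ℕ) (b : ι → ℕ → ℕ → ℝ) (t : ι)
    (x y : ℝ) :
    BIcc k p q b t x y = 1 + vnSum (k t) (p t) (q t) (b t) (fun _ _ => 1) x y := by
  simp [BIcc, vnSum]

lemma mul_natCast_mul_pow_sub_one (n : ℕ) (x : ℝ) : x * (n * x ^ (n - 1)) = n * x ^ n := by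
  cases n with
  | zero => simp
  | succ m => simp only [Nat.add_sub_cancel, pow_succ]; ring

lemma mul_deriv_AIcc {ι : Type*} (r s : ι → ℕ) (a : ι → ℕ → ℝ) (t : ι) (z : ℝ) :
    z * deriv (AIcc r s a t) z = cnSum (r t) (s t) (a t) (fun u => (u : ℝ)) z := by
  have h : HasDerivAt (AIcc r s a t)
      (∑ u ∈ Finset.Icc (r t) (s t), a t u * (u * z ^ (u - 1))) z :=
    (HasDerivAt.fun_sum fun u _ => (hasDerivAt_pow u z).const_mul (a t u)).const_add 1
  rw [h.deriv, cnSum, Finset.mul_sum]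
  refine Finset.sum_congr rfl fun u _ => ?_
  rw [mul_left_comm, mul_natCast_mul_pow_sub_one]
  ring

lemma mul_deriv_BIcc_left {ι : Type*} (k p q : ι → ℕ) (b : ι → ℕ → ℕ → ℝ) (t : ι)
    (x y : ℝ) :
    x * deriv (fun x => BIcc k p q b t x y) x
      = vnSum (k t) (p t) (q t) (b t) (fun i _ => (i : ℝ)) x y := by
  have h : HasDerivAt (fun x => BIcc k p q b t x y)
      (∑ i ∈ Finset.Icc 1 (k t), ∑ j ∈ Finset.Icc (p t) (q t),
        b t i j * (i * x ^ (i - 1)) * y ^ j) x :=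
    (HasDerivAt.fun_sum fun i _ => HasDerivAt.fun_sum fun j _ =>
      ((hasDerivAt_pow i x).const_mul (b t i j)).mul_const (y ^ j)).const_add 1
  rw [h.deriv, vnSum, Finset.mul_sum]
  refine Finset.sum_congr rfl fun i _ => ?_
  rw [Finset.mul_sum]
  refine Finset.sum_congr rfl fun j _ => ?_
  linear_combination (b t i j * y ^ j) * mul_natCast_mul_pow_sub_one i x

lemma mul_deriv_BIcc_right {ι : Type*} (k p q : ι → ℕ) (b : ι → ℕ → ℕ → ℝ) (t : ι)
    (x y : ℝ) :
    y * deriv (fun y => BIcc k p q b t x y) y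
      = vnSum (k t) (p t) (q t) (b t) (fun _ j => (j : ℝ)) x y := by
  have h : HasDerivAt (fun y => BIcc k p q b t x y)
      (∑ i ∈ Finset.Icc 1 (k t), ∑ j ∈ Finset.Icc (p t) (q t),
        b t i j * x ^ i * (j * y ^ (j - 1))) y :=
    (HasDerivAt.fun_sum fun i _ => HasDerivAt.fun_sum fun j _ =>
      (hasDerivAt_pow j y).const_mul (b t i j * x ^ i)).const_add 1
  rw [h.deriv, vnSum, Finset.mul_sum]
  refine Finset.sum_congr rfl fun i _ => ?_
  rw [Finset.mul_sum]
  refine Finset.sum_congr rfl fun j _ => ?_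
  linear_combination (b t i j * x ^ i) * mul_natCast_mul_pow_sub_one j y

lemma nodefrac_mul_intden {ι : Type*} [Fintype ι] (w : ι → ℝ) (n : ι → ℕ)
    (h : intden w n ≠ 0) (t : ι) : nodefrac w n t * intden w n = w t / n t := by
  rw [nodefrac, div_mul_eq_mul_div, mul_div_mul_right _ _ h]

lemma intden_pos {ι : Type*} [Fintype ι] [Nonempty ι] {w : ι → ℝ} {n : ι → ℕ}
    (hw : ∀ t, 0 < w t) (hn : ∀ t, 0 < n t) : 0 < intden w n :=
  Finset.sum_pos (fun t _ => div_pos (hw t) (Nat.cast_pos.2 (hn t))) Finset.univ_nonempty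

lemma intden_mul_sum_nodefrac {ι : Type*} [Fintype ι] {w : ι → ℝ} {n : ι → ℕ}
    (h : intden w n ≠ 0) (f : ι → ℝ) :
    intden w n * ∑ t, nodefrac w n t * f t = ∑ t, w t / n t * f t := by
  rw [Finset.mul_sum]
  refine Finset.sum_congr rfl fun t _ => ?_
  rw [← nodefrac_mul_intden w n h]
  ring

lemma vnSum_mono {k p q : ℕ} {b wt wt' : ℕ → ℕ → ℝ} {x y : ℝ} (hb : ∀ i j, 0 ≤ b i j)
    (hx : 0 ≤ x) (hy : 0 ≤ y)
    (h : ∀ i ∈ Finset.Icc 1 k, ∀ j ∈ Finset.Icc p q, wt i j ≤ wt' i j) :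
    vnSum k p q b wt x y ≤ vnSum k p q b wt' x y :=
  Finset.sum_le_sum fun i hi => Finset.sum_le_sum fun j hj =>
    mul_le_mul_of_nonneg_right (h i hi j hj)
      (mul_nonneg (mul_nonneg (hb i j) (pow_nonneg hx i)) (pow_nonneg hy j))

lemma vnSum_nonneg {k p q : ℕ} {b wt : ℕ → ℕ → ℝ} {x y : ℝ} (hb : ∀ i j, 0 ≤ b i j)
    (hwt : ∀ i j, 0 ≤ wt i j) (hx : 0 ≤ x) (hy : 0 ≤ y) : 0 ≤ vnSum k p q b wt x y :=
  Finset.sum_nonneg fun i _ => Finset.sum_nonneg fun j _ =>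
    mul_nonneg (hwt i j) (mul_nonneg (mul_nonneg (hb i j) (pow_nonneg hx i)) (pow_nonneg hy j))

lemma vnSum_const_mul (k p q : ℕ) (b wt : ℕ → ℕ → ℝ) (c x y : ℝ) :
    vnSum k p q b (fun i j => c * wt i j) x y = c * vnSum k p q b wt x y := by
  simp only [vnSum, Finset.mul_sum, mul_assoc]

lemma le_sum_sum {s t : Finset ℕ} {f : ℕ → ℕ → ℝ} (hf : ∀ i ∈ s, ∀ j ∈ t, 0 ≤ f i j)
    {i j : ℕ} (hi : i ∈ s) (hj : j ∈ t) : f i j ≤ ∑ i ∈ s, ∑ j ∈ t, f i j :=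
  (Finset.single_le_sum (hf i hi) hj).trans
    (Finset.single_le_sum (f := fun i => ∑ j ∈ t, f i j)
      (fun i hi => Finset.sum_nonneg (hf i hi)) hi)

lemma cnSum_nonneg {r s : ℕ} {a wt : ℕ → ℝ} {z : ℝ} (ha : ∀ u, 0 ≤ a u)
    (hwt : ∀ u, 0 ≤ wt u) (hz : 0 ≤ z) : 0 ≤ cnSum r s a wt z :=
  Finset.sum_nonneg fun u _ => mul_nonneg (hwt u) (mul_nonneg (ha u) (pow_nonneg hz u))

lemma monomial_div_eq {x y w ψ T : ℝ} (i j : ℕ) (hψ : 0 < ψ) (hw : 0 < w) :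
    x ^ i * y ^ j / w = (x * w ^ (T / ψ)) ^ i * (y / w ^ (1 / ψ)) ^ j
      * w ^ (((j : ℝ) - (ψ + i * T)) / ψ) := by
  have h1 : w ^ (((j : ℝ) - (ψ + i * T)) / ψ)
      = (w ^ (1 / ψ)) ^ j / (w * (w ^ (T / ψ)) ^ i) := by
    rw [← Real.rpow_natCast (w ^ (1 / ψ)), ← Real.rpow_natCast (w ^ (T / ψ)),
      ← Real.rpow_mul hw.le, ← Real.rpow_mul hw.le, eq_div_iff (by positivity)]
    nth_rewrite 2 [← Real.rpow_one w]
    rw [← Real.rpow_add hw, ← Real.rpow_add hw]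
    congr 1
    field_simp
    ring
  have h2 : 0 < w ^ (1 / ψ) := Real.rpow_pos_of_pos hw _
  have h3 : 0 < w ^ (T / ψ) := Real.rpow_pos_of_pos hw _
  rw [h1, mul_pow, div_pow]
  field_simp

/-- Rescaled monomials `x^i y^j / w` converge when `x w^{T/ψ}` and `y w^{-1/ψ}` do, provided
`(i,j)` lies on or above the line `j = ψ + i T`. -/
lemma tendsto_monomial_div {X : Type*} {l : Filter X} {x y w : X → ℝ} {i j : ℕ}
    {ψ T u₁ v₁ : ℝ} (hψ : 0 < ψ) (hw : ∀ᶠ s in l, 0 < w s) (hw0 : Tendsto w l (𝓝 0))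
    (hu : Tendsto (fun s => x s * w s ^ (T / ψ)) l (𝓝 u₁))
    (hv : Tendsto (fun s => y s / w s ^ (1 / ψ)) l (𝓝 v₁)) (he : ψ + i * T ≤ j) :
    Tendsto (fun s => x s ^ i * y s ^ j / w s) l
      (𝓝 (if (j : ℝ) = ψ + i * T then u₁ ^ i * v₁ ^ j else 0)) := by
  refine Tendsto.congr' (hw.mono fun s hs => (monomial_div_eq (T := T) i j hψ hs).symm) ?_
  split_ifs with h
  · simp only [h, sub_self, zero_div, Real.rpow_zero, mul_one]
    exact (hu.pow i).mul (hv.pow j)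
  · have hpos : 0 < ((j : ℝ) - (ψ + i * T)) / ψ :=
      div_pos (sub_pos.2 (lt_of_le_of_ne he (Ne.symm h))) hψ
    have h0 : Tendsto (fun s => w s ^ (((j : ℝ) - (ψ + i * T)) / ψ)) l (𝓝 0) := by
      simpa [Real.zero_rpow hpos.ne'] using hw0.rpow_const (Or.inr hpos.le)
    simpa using ((hu.pow i).mul (hv.pow j)).mul h0

lemma tendsto_vnSum_div {X : Type*} {l : Filter X} {x y w : X → ℝ} {k p q : ℕ}
    {b : ℕ → ℕ → ℝ} {ψ T u₁ v₁ : ℝ} (hψ : 0 < ψ)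
    (hT : ∀ i j, b i j ≠ 0 → T ≤ ((j : ℝ) - ψ) / i)
    (hw : ∀ᶠ s in l, 0 < w s) (hw0 : Tendsto w l (𝓝 0))
    (hu : Tendsto (fun s => x s * w s ^ (T / ψ)) l (𝓝 u₁))
    (hv : Tendsto (fun s => y s / w s ^ (1 / ψ)) l (𝓝 v₁)) (wt : ℕ → ℕ → ℝ) :
    Tendsto (fun s => vnSum k p q b wt (x s) (y s) / w s) l
      (𝓝 (tightSum k p q b ψ T wt v₁ u₁)) := by
  simp only [vnSum, tightSum, Finset.sum_div]
  refine tendsto_finsetSum _ fun i hi => tendsto_finsetSum _ fun j _ => ?_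
  have hi0 : (0 : ℝ) < i := Nat.cast_pos.2 (Finset.mem_Icc.1 hi).1
  by_cases hb : b i j = 0
  · simp only [hb, zero_mul, mul_zero, zero_div, ne_eq, not_true, false_and, if_false]
    exact tendsto_const_nhds
  have he : ψ + i * T ≤ j := by
    have := (le_div_iff₀ hi0).1 (hT i j hb)
    linarith
  have hiff : ((j : ℝ) - ψ) / i = T ↔ (j : ℝ) = ψ + i * T := by
    rw [div_eq_iff hi0.ne']
    constructor <;> intro h <;> linarith
  have h := (tendsto_monomial_div hψ hw hw0 hu hv he).const_mul (wt i j * b i j)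
  simp only [hb, hiff, ne_eq, not_false_eq_true, true_and]
  convert h using 2
  · ring
  · split_ifs <;> ring

lemma tendsto_cnSum_div {X : Type*} {l : Filter X} {z : X → ℝ} {r s m : ℕ} {a : ℕ → ℝ}
    (hmr : m ≤ r) (hrs : r ≤ s) (hz : ∀ᶠ x in l, 0 < z x) (hz0 : Tendsto z l (𝓝 0))
    (wt : ℕ → ℝ) :
    Tendsto (fun x => cnSum r s a wt (z x) / z x ^ m) l
      (𝓝 (if r = m then wt m * a m else 0)) := by
  have hsum : (if r = m then wt m * a m else 0)
      = ∑ u ∈ Finset.Icc r s, wt u * a u * (0 : ℝ) ^ (u - m) := by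
    split_ifs with h
    · subst h
      rw [Finset.sum_eq_single r]
      · simp
      · intro u hu hne
        have := (Finset.mem_Icc.1 hu).1
        rw [zero_pow (by omega), mul_zero]
      · intro h
        exact absurd (Finset.mem_Icc.2 ⟨le_rfl, hrs⟩) h
    · refine (Finset.sum_eq_zero fun u hu => ?_).symm
      have := (Finset.mem_Icc.1 hu).1
      rw [zero_pow (by omega), mul_zero]
  rw [hsum]
  refine Tendsto.congr' (f₁ := fun x => ∑ u ∈ Finset.Icc r s, wt u * a u * z x ^ (u - m)) ?_
    (tendsto_finsetSum _ fun u _ => (hz0.pow _).const_mul _)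
  filter_upwards [hz] with x hx
  rw [cnSum, Finset.sum_div]
  refine Finset.sum_congr rfl fun u hu => ?_
  have hmu : m ≤ u := hmr.trans (Finset.mem_Icc.1 hu).1
  rw [pow_sub₀ _ hx.ne' hmu]
  field_simp

/-- If `f / w → c` and `w → 0` then `log (1 + f) / w → c`. -/
lemma tendsto_log_one_add_div {X : Type*} {l : Filter X} {f w : X → ℝ} {c : ℝ}
    (hw : ∀ᶠ s in l, 0 < w s) (hw0 : Tendsto w l (𝓝 0))
    (hf : Tendsto (fun s => f s / w s) l (𝓝 c)) :
    Tendsto (fun s => Real.log (1 + f s) / w s) l (𝓝 c) := by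
  have hf0 : Tendsto f l (𝓝 0) := by
    have := hf.mul hw0
    rw [mul_zero] at this
    refine this.congr' ?_
    filter_upwards [hw] with s hs
    exact div_mul_cancel₀ _ hs.ne'
  have hd : Tendsto (dslope Real.log 1) (𝓝 1) (𝓝 1) := by
    have hc := continuousAt_dslope_same.2 (Real.differentiableAt_log one_ne_zero)
    simpa [ContinuousAt, dslope_same] using hc
  have h1 : Tendsto (fun s => 1 + f s) l (𝓝 1) := by simpa using hf0.const_add 1
  have h2 := (hd.comp h1).mul hf
  rw [one_mul] at h2
  refine h2.congr fun s => ?_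
  have h3 := sub_smul_dslope Real.log 1 (1 + f s)
  simp only [Real.log_one, sub_zero, smul_eq_mul, add_sub_cancel_left] at h3
  rw [← h3, Function.comp_apply]
  ring

/-- If the ratios `N / (1 + M)` tend to zero with `0 ≤ M ≤ N`, then `M` tends to zero. -/
lemma tendsto_zero_of_div_one_add {X : Type*} {l : Filter X} {M N : X → ℝ}
    (hM : ∀ᶠ s in l, 0 ≤ M s) (hMN : ∀ᶠ s in l, M s ≤ N s)
    (h : Tendsto (fun s => N s / (1 + M s)) l (𝓝 0)) : Tendsto M l (𝓝 0) := by
  have h1 : Tendsto (fun s => M s / (1 + M s)) l (𝓝 0) := by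
    refine squeeze_zero' ?_ ?_ h
    · filter_upwards [hM] with s hs
      positivity
    · filter_upwards [hM, hMN] with s hs hs'
      gcongr
  have h2 : Tendsto (fun s => (1 - M s / (1 + M s))⁻¹ - 1) l (𝓝 0) := by
    have := ((h1.const_sub 1).inv₀ (by norm_num)).sub_const 1
    simpa using this
  refine h2.congr' ?_
  filter_upwards [hM] with s hs
  have : (1 + M s) ≠ 0 := by positivity
  rw [one_sub_div this]
  simp

lemma tendsto_zero_of_sum {X ι : Type*} [Fintype ι] {l : Filter X} {c : ι → ℝ}
    {f : ι → X → ℝ} (hc : ∀ t, 0 < c t) (hf : ∀ᶠ s in l, ∀ t, 0 ≤ f t s)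
    (h : Tendsto (fun s => ∑ t, c t * f t s) l (𝓝 0)) (t : ι) : Tendsto (f t) l (𝓝 0) := by
  have h1 : Tendsto (fun s => c t * f t s) l (𝓝 0) := by
    refine squeeze_zero' ?_ ?_ h
    · filter_upwards [hf] with s hs
      exact mul_nonneg (hc t).le (hs t)
    · filter_upwards [hf] with s hs
      exact Finset.single_le_sum (f := fun t => c t * f t s)
        (fun t _ => mul_nonneg (hc t).le (hs t)) (Finset.mem_univ t)
  have h2 := h1.const_mul (c t)⁻¹
  rw [mul_zero] at h2
  exact h2.congr fun s => inv_mul_cancel_left₀ (hc t).ne' _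

lemma tendsto_zero_of_pow {X : Type*} {l : Filter X} {z : X → ℝ} {n : ℕ} (hn : n ≠ 0)
    (hz : ∀ᶠ s in l, 0 ≤ z s) (h : Tendsto (fun s => z s ^ n) l (𝓝 0)) :
    Tendsto z l (𝓝 0) := by
  have h1 : Tendsto (fun s => (z s ^ n) ^ ((n : ℝ)⁻¹)) l (𝓝 0) := by
    have := h.rpow_const (p := (n : ℝ)⁻¹) (Or.inr (by positivity))
    rwa [Real.zero_rpow (by positivity)] at this
  refine h1.congr' ?_
  filter_upwards [hz] with s hs
  exact Real.pow_rpow_inv_natCast hs hn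

lemma tightSum_strictMono {ι : Type*} [Fintype ι] {k p q : ι → ℕ} {b : ι → ℕ → ℕ → ℝ}
    {c : ι → ℝ} {ψ T v : ℝ} {wt : ℕ → ℕ → ℝ} (hc : ∀ t, 0 < c t) (hb : ∀ t i j, 0 ≤ b t i j)
    (hv : 0 < v) (hwt : ∀ i j, 0 ≤ wt i j)
    {t : ι} {i j : ℕ} (hi : i ∈ Finset.Icc 1 (k t)) (hj : j ∈ Finset.Icc (p t) (q t))
    (hbt : b t i j ≠ 0) (hT : ((j : ℝ) - ψ) / i = T) (hij : 0 < wt i j) {u u' : ℝ} (hu : 0 ≤ u)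
    (huu' : u < u') :
    ∑ t, c t * tightSum (k t) (p t) (q t) (b t) ψ T wt v u
      < ∑ t, c t * tightSum (k t) (p t) (q t) (b t) ψ T wt v u' := by
  refine Finset.sum_lt_sum (fun t _ => ?_) ⟨t, Finset.mem_univ t, ?_⟩
  · refine mul_le_mul_of_nonneg_left ?_ (hc t).le
    refine Finset.sum_le_sum fun i _ => Finset.sum_le_sum fun j _ => ?_
    have := hb t i j
    have := hwt i j
    split_ifs <;> gcongr
  · refine mul_lt_mul_of_pos_left ?_ (hc t)
    have hle : ∀ i j, (if b t i j ≠ 0 ∧ ((j : ℝ) - ψ) / i = T then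
          wt i j * (b t i j * u ^ i * v ^ j) else 0)
        ≤ if b t i j ≠ 0 ∧ ((j : ℝ) - ψ) / i = T then
          wt i j * (b t i j * u' ^ i * v ^ j) else 0 := by
      intro i j
      have := hb t i j
      have := hwt i j
      split_ifs <;> gcongr
    refine Finset.sum_lt_sum (fun i _ => Finset.sum_le_sum fun j _ => hle i j)
      ⟨i, hi, Finset.sum_lt_sum (fun j _ => hle i j) ⟨j, hj, ?_⟩⟩
    have hb0 : 0 < b t i j := lt_of_le_of_ne (hb t i j) (Ne.symm hbt)
    have hi0 : i ≠ 0 := by have := (Finset.mem_Icc.1 hi).1; omega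
    rw [if_pos ⟨hbt, hT⟩, if_pos ⟨hbt, hT⟩]
    gcongr

lemma tightSum_linear {k p q : ℕ} {b : ℕ → ℕ → ℝ} {ψ T v u : ℝ} :
    tightSum k p q b ψ T (fun _ j => (j : ℝ)) v u
      = ψ * tightSum k p q b ψ T (fun _ _ => 1) v u
        + T * tightSum k p q b ψ T (fun i _ => (i : ℝ)) v u := by
  simp only [tightSum, Finset.mul_sum, ← Finset.sum_add_distrib]
  refine Finset.sum_congr rfl fun i hi => Finset.sum_congr rfl fun j _ => ?_
  have hi0 : (i : ℝ) ≠ 0 := by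
    have := (Finset.mem_Icc.1 hi).1
    positivity
  split_ifs with h
  · have h2 := (div_eq_iff hi0).1 h.2
    linear_combination (b i j * u ^ i * v ^ j) * h2
  · ring

lemma Qdef_eq_sum_tightSum {ι : Type*} [Fintype ι] (k p q : ι → ℕ) (b : ι → ℕ → ℕ → ℝ)
    (lam : ι → ℝ) (r : ℕ) {T C L : ℝ} (hC : 0 ≤ C) (hL : 0 ≤ L) (wt : ℕ → ℕ → ℝ) (x : ℝ) :
    Qdef k p q b lam r T C L wt x
      = ∑ t, lam t / q t * tightSum (k t) (p t) (q t) (b t) (psiDef r) T wt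
          (C ^ (1 / (r : ℝ))) (x * (L / Real.exp 1) ^ (T / psiDef r)) := by
  refine Finset.sum_congr rfl fun t _ => ?_
  congr 1
  refine Finset.sum_congr rfl fun i _ => Finset.sum_congr rfl fun j _ => ?_
  split_ifs with h
  · have hL' : 0 ≤ L / Real.exp 1 := by positivity
    rw [mul_pow, ← Real.rpow_natCast (C ^ (1 / (r : ℝ))), ← Real.rpow_mul hC,
      ← Real.rpow_natCast ((L / Real.exp 1) ^ (T / psiDef r)), ← Real.rpow_mul hL',
      one_div_mul_eq_div, show T / psiDef r * (i : ℝ) = i * T / psiDef r by ring]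
    ring
  · rfl

lemma tendsto_zero_of_cnSum {X ι : Type*} [Fintype ι] [Nonempty ι] {l : Filter X} {w z : X → ℝ}
    {r s : ι → ℕ} {a : ι → ℕ → ℝ} {c : ι → ℝ} (hr : ∀ t, 1 ≤ r t) (hrs : ∀ t, r t ≤ s t)
    (ha : ∀ t u, 0 ≤ a t u) (har : ∀ t, 0 < a t (r t)) (hc : ∀ t, 0 < c t)
    (hz : ∀ᶠ x in l, 0 < z x) (hw0 : Tendsto w l (𝓝 0))
    (hE : ∀ᶠ x in l, ∑ t, c t * (cnSum (r t) (s t) (a t) (fun u => (u : ℝ)) (z x)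
      / (1 + cnSum (r t) (s t) (a t) (fun _ => 1) (z x))) = w x) :
    Tendsto z l (𝓝 0) := by
  obtain ⟨t⟩ := ‹Nonempty ι›
  have hM : ∀ t, ∀ x, 0 < z x → 0 ≤ cnSum (r t) (s t) (a t) (fun _ => 1) (z x) :=
    fun t x hx => cnSum_nonneg (ha t) (fun _ => zero_le_one) hx.le
  have h1 := tendsto_zero_of_sum hc (hz.mono fun x hx t => div_nonneg
    (cnSum_nonneg (ha t) (fun u => Nat.cast_nonneg u) hx.le)
    (add_nonneg zero_le_one (hM t x hx))) (hw0.congr' (hE.mono fun _ h => h.symm)) t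
  have h2 := tendsto_zero_of_div_one_add (hz.mono fun x hx => hM t x hx)
    (hz.mono fun x hx => Finset.sum_le_sum fun u hu => mul_le_mul_of_nonneg_right
      (Nat.one_le_cast.2 ((hr t).trans (Finset.mem_Icc.1 hu).1))
      (mul_nonneg (ha t u) (pow_nonneg hx.le u))) h1
  have h3 : Tendsto (fun x => a t (r t) * z x ^ r t) l (𝓝 0) := by
    refine squeeze_zero' (hz.mono fun x hx => ?_) (hz.mono fun x hx => ?_) h2
    · exact mul_nonneg (ha t _) (pow_nonneg hx.le _)
    · have := Finset.single_le_sum (f := fun u => (1 : ℝ) * (a t u * z x ^ u))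
        (fun u _ => mul_nonneg zero_le_one (mul_nonneg (ha t u) (pow_nonneg hx.le u)))
        (Finset.mem_Icc.2 ⟨le_rfl, hrs t⟩)
      simpa only [cnSum, one_mul] using this
  refine tendsto_zero_of_pow (n := r t) (by have := hr t; omega) (hz.mono fun _ h => h.le) ?_
  have h4 := h3.const_mul (a t (r t))⁻¹
  rw [mul_zero] at h4
  exact h4.congr fun x => inv_mul_cancel_left₀ (har t).ne' _

lemma tendsto_sum_div_one_add {X ι : Type*} [Fintype ι] {l : Filter X} {w : X → ℝ}
    {c : ι → ℝ} {M N : ι → X → ℝ} {d : ι → ℝ} (hM : ∀ t, Tendsto (M t) l (𝓝 0))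
    (hN : ∀ t, Tendsto (fun x => N t x / w x) l (𝓝 (d t))) :
    Tendsto (fun x => (∑ t, c t * (N t x / (1 + M t x))) / w x) l (𝓝 (∑ t, c t * d t)) := by
  simp only [Finset.sum_div]
  refine tendsto_finsetSum _ fun t _ => ?_
  have h := ((hN t).div ((hM t).const_add 1) (by norm_num)).const_mul (c t)
  simp only [add_zero, div_one] at h
  refine h.congr fun x => ?_
  rw [Pi.div_apply]
  ring

lemma tendsto_sum_log_div {X ι : Type*} [Fintype ι] {l : Filter X} {w : X → ℝ}
    {c : ι → ℝ} {M : ι → X → ℝ} {d : ι → ℝ} (hw : ∀ᶠ x in l, 0 < w x)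
    (hw0 : Tendsto w l (𝓝 0)) (hM : ∀ t, Tendsto (fun x => M t x / w x) l (𝓝 (d t))) :
    Tendsto (fun x => (∑ t, c t * Real.log (1 + M t x)) / w x) l (𝓝 (∑ t, c t * d t)) := by
  simp only [Finset.sum_div, mul_div_assoc]
  exact tendsto_finsetSum _ fun t _ => (tendsto_log_one_add_div hw hw0 (hM t)).const_mul (c t)

/-- The rescaled variable `x w^{T/ψ}` stays bounded, because a single extremal monomial is
dominated by `w`. -/
lemma eventually_rescaled_le {X ι : Type*} [Fintype ι] {l : Filter X} {x y w : X → ℝ}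
    {k p q : ι → ℕ} {b : ι → ℕ → ℕ → ℝ} {c : ι → ℝ} {ψ T v₁ : ℝ} (hψ : 0 < ψ)
    (hc : ∀ t, 0 < c t) (hb : ∀ t i j, 0 ≤ b t i j)
    (hxy : ∀ᶠ s in l, 0 < x s ∧ 0 < y s ∧ 0 < w s) {t : ι} {i j : ℕ}
    (hi : i ∈ Finset.Icc 1 (k t)) (hj : j ∈ Finset.Icc (p t) (q t)) (hj0 : j ≠ 0)
    (hbt : b t i j ≠ 0) (htight : ((j : ℝ) - ψ) / i = T)
    (hM : Tendsto (fun s => vnSum (k t) (p t) (q t) (b t) (fun _ _ => 1) (x s) (y s)) l (𝓝 0))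
    (hv : Tendsto (fun s => y s / w s ^ (1 / ψ)) l (𝓝 v₁)) (hv₁ : 0 < v₁)
    (hE : ∀ᶠ s in l, ∑ t, c t * (vnSum (k t) (p t) (q t) (b t) (fun _ j => (j : ℝ)) (x s) (y s)
      / (1 + vnSum (k t) (p t) (q t) (b t) (fun _ _ => 1) (x s) (y s))) = w s) :
    ∃ K : ℝ, ∀ᶠ s in l, x s * w s ^ (T / ψ) ≤ K := by
  have hi1 : 1 ≤ i := (Finset.mem_Icc.1 hi).1
  have hb0 : 0 < b t i j := lt_of_le_of_ne (hb t i j) (Ne.symm hbt)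
  have hct := hc t
  have hj1 : (0 : ℝ) < j := by positivity
  have hi0 : (0 : ℝ) < i := by positivity
  refine ⟨max 1 (2 / (c t * (j * b t i j) * (v₁ / 2) ^ j)), ?_⟩
  filter_upwards [hxy, hE, hM.eventually_lt_const one_pos,
    hv.eventually_const_lt (half_lt_self hv₁)] with s hs hEs hMs hvs
  obtain ⟨hx, hy, hw⟩ := hs
  have hM0 : ∀ t, 0 ≤ vnSum (k t) (p t) (q t) (b t) (fun _ _ => 1) (x s) (y s) := fun t =>
    vnSum_nonneg (hb t) (fun _ _ => zero_le_one) hx.le hy.le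
  have hN0 : ∀ t, 0 ≤ vnSum (k t) (p t) (q t) (b t) (fun _ j => (j : ℝ)) (x s) (y s) := fun t =>
    vnSum_nonneg (hb t) (fun _ j => Nat.cast_nonneg j) hx.le hy.le
  have h1 : c t * (vnSum (k t) (p t) (q t) (b t) (fun _ j => (j : ℝ)) (x s) (y s)
      / (1 + vnSum (k t) (p t) (q t) (b t) (fun _ _ => 1) (x s) (y s))) ≤ w s := by
    rw [← hEs]
    exact Finset.single_le_sum (f := fun t => c t * (vnSum (k t) (p t) (q t) (b t)
        (fun _ j => (j : ℝ)) (x s) (y s)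
        / (1 + vnSum (k t) (p t) (q t) (b t) (fun _ _ => 1) (x s) (y s))))
      (fun t _ => mul_nonneg (hc t).le (div_nonneg (hN0 t) (by linarith [hM0 t])))
      (Finset.mem_univ t)
  have h2 : (j : ℝ) * (b t i j * x s ^ i * y s ^ j)
      ≤ vnSum (k t) (p t) (q t) (b t) (fun _ j => (j : ℝ)) (x s) (y s) :=
    le_sum_sum (f := fun i j => (j : ℝ) * (b t i j * x s ^ i * y s ^ j))
      (fun i _ j _ => by have := hb t i j; positivity) hi hj
  have h3 : c t * vnSum (k t) (p t) (q t) (b t) (fun _ j => (j : ℝ)) (x s) (y s) ≤ w s * 2 := by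
    have h4 : 0 < 1 + vnSum (k t) (p t) (q t) (b t) (fun _ _ => 1) (x s) (y s) := by
      linarith [hM0 t]
    rw [← mul_div_assoc, div_le_iff₀ h4] at h1
    refine h1.trans (mul_le_mul_of_nonneg_left ?_ hw.le)
    linarith
  have h5 : x s ^ i * y s ^ j / w s = (x s * w s ^ (T / ψ)) ^ i * (y s / w s ^ (1 / ψ)) ^ j := by
    rw [monomial_div_eq (T := T) i j hψ hw]
    have : (j : ℝ) - (ψ + i * T) = 0 := by
      rw [← htight]
      field_simp
      ring
    rw [this, zero_div, Real.rpow_zero, mul_one]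
  have hu : 0 < x s * w s ^ (T / ψ) := mul_pos hx (Real.rpow_pos_of_pos hw _)
  set u := x s * w s ^ (T / ψ)
  have h6 : c t * (j * b t i j) * (u ^ i * (y s / w s ^ (1 / ψ)) ^ j) ≤ 2 := by
    rw [← h5, ← mul_div_assoc, div_le_iff₀ hw]
    calc c t * (j * b t i j) * (x s ^ i * y s ^ j)
        = c t * (j * (b t i j * x s ^ i * y s ^ j)) := by ring
      _ ≤ w s * 2 := (mul_le_mul_of_nonneg_left h2 hct.le).trans h3
      _ = 2 * w s := mul_comm _ _
  have h7 : u ^ i ≤ 2 / (c t * (j * b t i j) * (v₁ / 2) ^ j) := by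
    rw [le_div_iff₀ (by positivity)]
    calc u ^ i * (c t * (j * b t i j) * (v₁ / 2) ^ j)
        = c t * (j * b t i j) * (u ^ i * (v₁ / 2) ^ j) := by ring
      _ ≤ c t * (j * b t i j) * (u ^ i * (y s / w s ^ (1 / ψ)) ^ j) := by gcongr
      _ ≤ 2 := h6
  rcases le_total u 1 with h | h
  · exact h.trans (le_max_left _ _)
  · exact (le_self_pow₀ h (by omega)).trans (h7.trans (le_max_right _ _))

/-- The rescaled variable `x w^{T/ψ}` converges to the root of the limiting equation. -/
lemma tendsto_rescaled {X ι : Type*} [Fintype ι] {l : Filter X} {x y w : X → ℝ}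
    {k p q : ι → ℕ} {b : ι → ℕ → ℕ → ℝ} {c : ι → ℝ} {ψ T v₁ u₁ : ℝ} (hψ : 0 < ψ)
    (hc : ∀ t, 0 < c t) (hb : ∀ t i j, 0 ≤ b t i j)
    (hT : ∀ t i j, b t i j ≠ 0 → T ≤ ((j : ℝ) - ψ) / i)
    (hxy : ∀ᶠ s in l, 0 < x s ∧ 0 < y s ∧ 0 < w s) {t : ι} {i j : ℕ}
    (hi : i ∈ Finset.Icc 1 (k t)) (hj : j ∈ Finset.Icc (p t) (q t)) (hj0 : j ≠ 0)
    (hbt : b t i j ≠ 0) (htight : ((j : ℝ) - ψ) / i = T) (hw0 : Tendsto w l (𝓝 0))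
    (hM : ∀ t, Tendsto
      (fun s => vnSum (k t) (p t) (q t) (b t) (fun _ _ => 1) (x s) (y s)) l (𝓝 0))
    (hv : Tendsto (fun s => y s / w s ^ (1 / ψ)) l (𝓝 v₁)) (hv₁ : 0 < v₁) (hu₁ : 0 ≤ u₁)
    (hE : ∀ᶠ s in l, ∑ t, c t * (vnSum (k t) (p t) (q t) (b t) (fun _ j => (j : ℝ)) (x s) (y s)
      / (1 + vnSum (k t) (p t) (q t) (b t) (fun _ _ => 1) (x s) (y s))) = w s)
    (hroot : ∑ t, c t * tightSum (k t) (p t) (q t) (b t) ψ T (fun _ j => (j : ℝ)) v₁ u₁ = 1) :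
    Tendsto (fun s => x s * w s ^ (T / ψ)) l (𝓝 u₁) := by
  obtain ⟨K, hK⟩ := eventually_rescaled_le hψ hc hb hxy hi hj hj0 hbt htight (hM t) hv hv₁ hE
  rw [tendsto_iff_ultrafilter]
  intro g hg
  have hmem : ∀ᶠ s in (g : Filter X), x s * w s ^ (T / ψ) ∈ Set.Icc 0 K := by
    filter_upwards [hg hxy, hg hK] with s hs hs'
    exact ⟨(mul_pos hs.1 (Real.rpow_pos_of_pos hs.2.2 _)).le, hs'⟩
  obtain ⟨u', hu', hlim⟩ := (isCompact_Icc (a := (0 : ℝ)) (b := K)).ultrafilter_le_nhds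
    (g.map fun s => x s * w s ^ (T / ψ)) (by rw [le_principal_iff]; exact hmem)
  have hlim' : Tendsto (fun s => x s * w s ^ (T / ψ)) g (𝓝 u') := hlim
  have hwg : ∀ᶠ s in (g : Filter X), 0 < w s := hg (hxy.mono fun s h => h.2.2)
  have h1 := tendsto_sum_div_one_add (c := c) (fun t => (hM t).mono_left hg) fun t =>
    tendsto_vnSum_div (k := k t) (p := p t) (q := q t) hψ (hT t) hwg (hw0.mono_left hg) hlim'
      (hv.mono_left hg) (fun _ j => (j : ℝ))
  have h2 : ∑ t, c t * tightSum (k t) (p t) (q t) (b t) ψ T (fun _ j => (j : ℝ)) v₁ u' = 1 := by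
    refine tendsto_nhds_unique h1 (tendsto_const_nhds.congr' ?_)
    filter_upwards [hg hE, hwg] with s hs hs'
    rw [hs, div_self hs'.ne']
  have hmono : ∀ {u u' : ℝ}, 0 ≤ u → u < u' → _ := fun hu huu' =>
    tightSum_strictMono (k := k) (p := p) (q := q) (wt := fun _ j => (j : ℝ)) hc hb hv₁
      (fun _ j => Nat.cast_nonneg j) hi hj hbt htight (by positivity) hu huu'
  have h3 : u' = u₁ := by
    rcases lt_trichotomy u' u₁ with h | h | h
    · exact absurd (h2.trans hroot.symm) (hmono hu'.1 h).ne
    · exact h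
    · exact absurd (hroot.trans h2.symm) (hmono hu₁ h).ne
  exact h3 ▸ hlim'

lemma Cdef_eq_sum {ι : Type*} [Fintype ι] (rc sc : ι → ℕ) (a : ι → ℕ → ℝ) (ρ : ι → ℝ)
    (m : ℕ) :
    Cdef rc sc a ρ m = ∑ t, ρ t / sc t * (if rc t = m then (m : ℝ) * a t m else 0) := by
  rw [Cdef, Finset.sum_filter, Finset.mul_sum]
  refine Finset.sum_congr rfl fun t _ => ?_
  split_ifs <;> ring

/-- The relation `w (1 + y z) = y z` with `w ~ C z^m` forces `y ~ C^{1/m} w^{1/ψ}`. -/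
lemma tendsto_div_rpow_of_saddle {X : Type*} {l : Filter X} {w y z : X → ℝ} {m : ℕ} {ψ C : ℝ}
    (hm : m ≠ 0) (hψm : 1 / ψ + 1 / (m : ℝ) = 1) (hC : 0 < C) (hw : ∀ᶠ s in l, 0 < w s)
    (hz : ∀ᶠ s in l, 0 < z s) (hw0 : Tendsto w l (𝓝 0))
    (hwz : Tendsto (fun s => w s / z s ^ m) l (𝓝 C))
    (hE : ∀ᶠ s in l, w s * (1 + y s * z s) = y s * z s) :
    Tendsto (fun s => y s / w s ^ (1 / ψ)) l (𝓝 (C ^ (1 / (m : ℝ)))) := by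
  have h1 := (hwz.rpow_const (p := 1 / (m : ℝ)) (Or.inl hC.ne')).div (hw0.const_sub 1)
    (by norm_num)
  rw [sub_zero, div_one] at h1
  refine h1.congr' ?_
  filter_upwards [hw, hz, hE, hw0.eventually_lt_const one_pos] with s hws hzs hEs hw1
  have h2 : (z s ^ m) ^ (1 / (m : ℝ)) = z s := by
    rw [one_div]
    exact Real.pow_rpow_inv_natCast hzs.le hm
  have h3 : w s ^ (1 / (m : ℝ)) * w s ^ (1 / ψ) = w s := by
    rw [← Real.rpow_add hws, add_comm, hψm, Real.rpow_one]
  have h4 : 0 < w s ^ (1 / ψ) := Real.rpow_pos_of_pos hws _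
  have h5 : 0 < 1 - w s := sub_pos.2 hw1
  rw [Pi.div_apply, Real.div_rpow hws.le (pow_pos hzs m).le, h2, div_div,
    div_eq_div_iff (by positivity) h4.ne', h3]
  linear_combination hEs

/-- Assembles the expansion of the growth rate from the limits of its pieces divided by `w`. -/
lemma tendsto_growth_rate {X : Type*} {l : Filter X} {α x w V A : X → ℝ}
    {L τ κ u₁ v₀ a₀ : ℝ} (hL : 0 < L) (hκ : 0 < κ) (hu₁ : 0 < u₁)
    (hpos : ∀ᶠ s in l, 0 < α s ∧ 0 < x s ∧ 0 < w s) (hw0 : Tendsto w l (𝓝 0))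
    (hα : Tendsto (fun s => α s * L / w s) l (𝓝 κ))
    (hV : Tendsto (fun s => V s / w s) l (𝓝 v₀)) (hA : Tendsto (fun s => A s / w s) l (𝓝 a₀))
    (hu : Tendsto (fun s => x s * w s ^ τ) l (𝓝 u₁)) :
    Tendsto (fun s => ((V s / L - α s * Real.log (x s) + A s / L + Real.log (1 - w s) / L)
        - τ * α s * Real.log (α s)) / α s) l
      (𝓝 (κ⁻¹ * (v₀ + a₀ - 1) - Real.log u₁ + τ * (Real.log L - Real.log κ))) := by
  have hlog : Tendsto (fun s => Real.log (1 + -w s) / w s) l (𝓝 (-1)) := by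
    refine tendsto_log_one_add_div (hpos.mono fun s h => h.2.2) hw0
      (tendsto_const_nhds.congr' (hpos.mono fun s h => ?_))
    change -1 = -w s / w s
    rw [neg_div, div_self h.2.2.ne']
  have h1 := (((hα.inv₀ hκ.ne').mul ((hV.add hA).add hlog)).sub
    (hu.log hu₁.ne')).add ((hα.log hκ.ne').const_sub (Real.log L) |>.const_mul τ)
  rw [← sub_eq_add_neg] at h1
  refine h1.congr' ?_
  filter_upwards [hpos] with s ⟨hs1, hs2, hs3⟩
  rw [Real.log_mul hs2.ne' (Real.rpow_pos_of_pos hs3 _).ne', Real.log_rpow hs3,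
    Real.log_div (by positivity) hs3.ne', Real.log_mul hs1.ne' hL.ne', ← sub_eq_add_neg]
  field_simp
  ring

/-- small-`α` behavior of the growth rate.  If positive functions
`x₀, y₀, z₀, β` on `(0,ε₀)` satisfy `β∫λ < 1` and the saddle-point system (E1)–(E4), then
`(G(α) − (T/ψ)α log α)/α → −log x₁ − (T/ψ) log Q₂(x₁)` as `α → 0⁺`, i.e.
`G(α) = (T/ψ)α log α + α[log(1/x₁) + (T/ψ)log(1/Q₂(x₁))] + o(α)`,
where `x₁` is the (unique) positive real with `Q₁(x₁) = 1`. -/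
theorem stmt_18 {ιc ιv : Type*} [Fintype ιc] [Nonempty ιc] [Fintype ιv] [Nonempty ιv]
    (rc sc : ιc → ℕ) (h2r : ∀ t, 2 ≤ rc t) (hrs : ∀ t, rc t ≤ sc t)
    (a : ιc → ℕ → ℝ) (hann : ∀ t u, 0 ≤ a t u) (har : ∀ t, 0 < a t (rc t))
    (kv pv qv : ιv → ℕ) (hkv : ∀ t, 1 ≤ kv t) (hpv : ∀ t, 2 ≤ pv t) (hpq : ∀ t, pv t ≤ qv t)
    (b : ιv → ℕ → ℕ → ℝ) (hbnn : ∀ t u v, 0 ≤ b t u v)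
    (hbsupp : ∀ t u v, b t u v ≠ 0 → u ∈ Finset.Icc 1 (kv t) ∧ v ∈ Finset.Icc (pv t) (qv t))
    (hbne : ∀ t, ∃ u v, b t u v ≠ 0)
    (ρ : ιc → ℝ) (lam : ιv → ℝ) (hρ : ∀ t, 0 < ρ t) (hlam : ∀ t, 0 < lam t)
    (hρ1 : ∑ t, ρ t = 1) (hlam1 : ∑ t, lam t = 1)
    (rmin : ℕ) (hrle : ∀ t, rmin ≤ rc t) (hrex : ∃ t, rc t = rmin)
    (T : ℝ)
    (hT : IsLeast {x : ℝ | ∃ t i j, b t i j ≠ 0 ∧ x = ((j : ℝ) - psiDef rmin) / i} T)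
    (x₁ : ℝ) (hx₁pos : 0 < x₁)
    (hx₁ : Qdef kv pv qv b lam rmin T (Cdef rc sc a ρ rmin) (intden lam qv)
      (fun _ j => (j : ℝ)) x₁ = 1)
    (ε₀ : ℝ) (hε₀ : 0 < ε₀)
    (x₀ y₀ z₀ β : ℝ → ℝ)
    (hpos : ∀ α ∈ Set.Ioo 0 ε₀, 0 < x₀ α ∧ 0 < y₀ α ∧ 0 < z₀ α ∧ 0 < β α)
    (hβL : ∀ α ∈ Set.Ioo 0 ε₀, β α * intden lam qv < 1)
    (hE1 : ∀ α ∈ Set.Ioo 0 ε₀,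
      z₀ α * ((intden ρ sc / intden lam qv) *
        ∑ t, nodefrac ρ sc t * deriv (AIcc rc sc a t) (z₀ α) / AIcc rc sc a t (z₀ α)) = β α)
    (hE2 : ∀ α ∈ Set.Ioo 0 ε₀,
      x₀ α * ∑ t, nodefrac lam qv t *
        deriv (fun x => BIcc kv pv qv b t x (y₀ α)) (x₀ α)
          / BIcc kv pv qv b t (x₀ α) (y₀ α) = α)
    (hE3 : ∀ α ∈ Set.Ioo 0 ε₀,
      y₀ α * ∑ t, nodefrac lam qv t *
        deriv (fun y => BIcc kv pv qv b t (x₀ α) y) (y₀ α)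
          / BIcc kv pv qv b t (x₀ α) (y₀ α) = β α)
    (hE4 : ∀ α ∈ Set.Ioo 0 ε₀,
      (β α * intden lam qv) * (1 + y₀ α * z₀ α) = y₀ α * z₀ α) :
    Filter.Tendsto
      (fun α =>
        ((∑ t, nodefrac lam qv t * Real.log (BIcc kv pv qv b t (x₀ α) (y₀ α))
            - α * Real.log (x₀ α)
            + (intden ρ sc / intden lam qv) *
                ∑ t, nodefrac ρ sc t * Real.log (AIcc rc sc a t (z₀ α))
            + Real.log (1 - β α * intden lam qv) / intden lam qv)
          - (T / psiDef rmin) * α * Real.log α) / α)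
      (nhdsWithin 0 (Set.Ioi 0))
      (𝓝 (-Real.log x₁ - (T / psiDef rmin) *
        Real.log (Qdef kv pv qv b lam rmin T (Cdef rc sc a ρ rmin) (intden lam qv)
          (fun i _ => (i : ℝ)) x₁))) := by
  have hm : 2 ≤ rmin := by
    obtain ⟨t, ht⟩ := hrex
    exact ht ▸ h2r t
  have hm' : (2 : ℝ) ≤ rmin := by exact_mod_cast hm
  have hψ : 0 < psiDef rmin := div_pos (by linarith) (by linarith)
  have hψm : 1 / psiDef rmin + 1 / (rmin : ℝ) = 1 := by
    rw [psiDef, one_div_div]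
    field_simp
    ring
  have hqpos : ∀ t, 0 < qv t := fun t => by have := hpv t; have := hpq t; omega
  have hspos : ∀ t, 0 < sc t := fun t => by have := h2r t; have := hrs t; omega
  have hL : 0 < intden lam qv := intden_pos hlam hqpos
  have hR : 0 < intden ρ sc := intden_pos hρ hspos
  have hc : ∀ t, 0 < lam t / qv t := fun t => div_pos (hlam t) (Nat.cast_pos.2 (hqpos t))
  have hd : ∀ t, 0 < ρ t / sc t := fun t => div_pos (hρ t) (Nat.cast_pos.2 (hspos t))
  have hC := Cdef_eq_sum rc sc a ρ rmin
  have hCpos : 0 < Cdef rc sc a ρ rmin := by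
    rw [hC]
    obtain ⟨t, ht⟩ := hrex
    refine Finset.sum_pos' (fun t _ => mul_nonneg (hd t).le ?_)
      ⟨t, Finset.mem_univ t, mul_pos (hd t) ?_⟩
    · have := hann t rmin
      split_ifs <;> positivity
    · have := har t
      rw [ht] at this
      rw [if_pos ht]
      positivity
  set L := intden lam qv
  set C := Cdef rc sc a ρ rmin
  set ψ := psiDef rmin with hψdef
  set l := 𝓝[>] (0 : ℝ)
  set w : ℝ → ℝ := fun α => β α * L
  have hev : ∀ᶠ α in l, α ∈ Set.Ioo 0 ε₀ := Ioo_mem_nhdsGT hε₀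
  have hcE : ∀ (f : ιv → ℝ), L * ∑ t, nodefrac lam qv t * f t = ∑ t, lam t / qv t * f t :=
    intden_mul_sum_nodefrac hL.ne'
  have hdE : ∀ (f : ιc → ℝ), intden ρ sc * ∑ t, nodefrac ρ sc t * f t
      = ∑ t, ρ t / sc t * f t := intden_mul_sum_nodefrac hR.ne'
  have hE1' : ∀ᶠ α in l, ∑ t, ρ t / sc t *
      (cnSum (rc t) (sc t) (a t) (fun u => (u : ℝ)) (z₀ α)
        / (1 + cnSum (rc t) (sc t) (a t) (fun _ => 1) (z₀ α))) = w α := by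
    filter_upwards [hev] with α hα
    change _ = β α * L
    rw [← hE1 α hα, ← hdE]
    simp only [← mul_deriv_AIcc, ← AIcc_eq_one_add_cnSum, mul_div_assoc, Finset.mul_sum,
      Finset.sum_mul]
    refine Finset.sum_congr rfl fun t _ => ?_
    field_simp
  have hE2' : ∀ᶠ α in l, ∑ t, lam t / qv t *
      (vnSum (kv t) (pv t) (qv t) (b t) (fun i _ => (i : ℝ)) (x₀ α) (y₀ α)
        / (1 + vnSum (kv t) (pv t) (qv t) (b t) (fun _ _ => 1) (x₀ α) (y₀ α))) = α * L := by
    filter_upwards [hev] with α hα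
    rw [← hcE]
    conv_rhs => rw [mul_comm, ← hE2 α hα]
    simp only [← mul_deriv_BIcc_left, ← BIcc_eq_one_add_vnSum, Finset.mul_sum]
    refine Finset.sum_congr rfl fun t _ => ?_
    ring
  have hE3' : ∀ᶠ α in l, ∑ t, lam t / qv t *
      (vnSum (kv t) (pv t) (qv t) (b t) (fun _ j => (j : ℝ)) (x₀ α) (y₀ α)
        / (1 + vnSum (kv t) (pv t) (qv t) (b t) (fun _ _ => 1) (x₀ α) (y₀ α))) = w α := by
    filter_upwards [hev] with α hα
    change _ = β α * L
    rw [← hE3 α hα, ← hcE]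
    simp only [← mul_deriv_BIcc_right, ← BIcc_eq_one_add_vnSum, Finset.mul_sum, Finset.sum_mul]
    refine Finset.sum_congr rfl fun t _ => ?_
    ring
  have hα : ∀ᶠ α in l, 0 < α := hev.mono fun α h => h.1
  have hα0 : Tendsto (fun α : ℝ => α) l (𝓝 0) := tendsto_id.mono_left nhdsWithin_le_nhds
  have hwpos : ∀ᶠ α in l, 0 < w α := hev.mono fun α h => mul_pos (hpos α h).2.2.2 hL
  have hzpos : ∀ᶠ α in l, 0 < z₀ α := hev.mono fun α h => (hpos α h).2.2.1
  have hxy : ∀ᶠ α in l, 0 < x₀ α ∧ 0 < y₀ α ∧ 0 < w α :=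
    (hev.and hwpos).mono fun α h => ⟨(hpos α h.1).1, (hpos α h.1).2.1, h.2⟩
  have hM0 : ∀ᶠ α in l, ∀ t,
      0 ≤ vnSum (kv t) (pv t) (qv t) (b t) (fun _ _ => 1) (x₀ α) (y₀ α) :=
    hxy.mono fun α h t => vnSum_nonneg (hbnn t) (fun _ _ => zero_le_one) h.1.le h.2.1.le
  set D : ℝ := ∑ t, (qv t : ℝ)
  have hDle : ∀ t, (qv t : ℝ) ≤ D := fun t =>
    Finset.single_le_sum (f := fun t => (qv t : ℝ)) (fun t _ => Nat.cast_nonneg _)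
      (Finset.mem_univ t)
  have hD : 0 < D := Finset.sum_pos (fun t _ => Nat.cast_pos.2 (hqpos t)) Finset.univ_nonempty
  have hwle : ∀ᶠ α in l, w α ≤ D * (α * L) := by
    filter_upwards [hE2', hE3', hxy, hM0] with α h2 h3 hp hM
    rw [← h2, ← h3, Finset.mul_sum]
    refine Finset.sum_le_sum fun t _ => ?_
    rw [mul_left_comm D, ← mul_div_assoc D, ← vnSum_const_mul _ _ _ _ _ D]
    refine mul_le_mul_of_nonneg_left
      (div_le_div_of_nonneg_right ?_ (add_nonneg zero_le_one (hM t))) (hc t).le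
    refine vnSum_mono (hbnn t) hp.1.le hp.2.1.le fun i hi j hj => ?_
    have hi1 : (1 : ℝ) ≤ i := Nat.one_le_cast.2 (Finset.mem_Icc.1 hi).1
    have hjq : (j : ℝ) ≤ D := (Nat.cast_le.2 (Finset.mem_Icc.1 hj).2).trans (hDle t)
    nlinarith
  have hw0 : Tendsto w l (𝓝 0) := by
    refine squeeze_zero' (hwpos.mono fun _ h => h.le) hwle ?_
    simpa using (hα0.mul_const L).const_mul D
  have hMlim : ∀ t, Tendsto
      (fun α => vnSum (kv t) (pv t) (qv t) (b t) (fun _ _ => 1) (x₀ α) (y₀ α)) l (𝓝 0) := by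
    intro t
    refine tendsto_zero_of_div_one_add (hM0.mono fun α h => h t) (hxy.mono fun α h =>
      vnSum_mono (wt' := fun i _ => (i : ℝ)) (hbnn t) h.1.le h.2.1.le fun i hi j _ =>
        Nat.one_le_cast.2 (Finset.mem_Icc.1 hi).1) ?_
    refine tendsto_zero_of_sum (f := fun t α =>
      vnSum (kv t) (pv t) (qv t) (b t) (fun i _ => (i : ℝ)) (x₀ α) (y₀ α)
        / (1 + vnSum (kv t) (pv t) (qv t) (b t) (fun _ _ => 1) (x₀ α) (y₀ α))) hc ?_ ?_ t
    · filter_upwards [hxy, hM0] with α h hM t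
      have := hM t
      exact div_nonneg (vnSum_nonneg (hbnn t) (fun i _ => Nat.cast_nonneg i) h.1.le h.2.1.le)
        (by positivity)
    · refine Tendsto.congr' (hE2'.mono fun α h => h.symm) ?_
      simpa using hα0.mul_const L
  have hz0 : Tendsto z₀ l (𝓝 0) := tendsto_zero_of_cnSum
    (fun t => one_le_two.trans (h2r t)) hrs hann har hd hzpos hw0 hE1'
  have hcn : ∀ (wt : ℕ → ℝ) t, Tendsto
      (fun α => cnSum (rc t) (sc t) (a t) wt (z₀ α) / z₀ α ^ rmin) l
      (𝓝 (if rc t = rmin then wt rmin * a t rmin else 0)) := fun wt t =>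
    tendsto_cnSum_div (hrle t) (hrs t) hzpos hz0 wt
  have hzm0 : Tendsto (fun α => z₀ α ^ rmin) l (𝓝 0) := by
    have := hz0.pow rmin
    rwa [zero_pow (by omega)] at this
  have hzmpos : ∀ᶠ α in l, 0 < z₀ α ^ rmin := hzpos.mono fun α h => pow_pos h _
  have hN0 : ∀ t, Tendsto (fun α => cnSum (rc t) (sc t) (a t) (fun _ => 1) (z₀ α)) l (𝓝 0) := by
    intro t
    have := (hcn (fun _ => 1) t).mul hzm0
    rw [mul_zero] at this
    exact this.congr' (hzmpos.mono fun α h => div_mul_cancel₀ _ h.ne')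
  have hwz : Tendsto (fun α => w α / z₀ α ^ rmin) l (𝓝 C) := by
    rw [hC]
    refine (tendsto_sum_div_one_add hN0 (hcn fun u => (u : ℝ))).congr' ?_
    filter_upwards [hE1'] with α h
    rw [h]
  have hCN : Tendsto (fun α => (∑ t, ρ t / sc t * Real.log (AIcc rc sc a t (z₀ α))) / w α) l
      (𝓝 (1 / rmin)) := by
    have h1 := (tendsto_sum_log_div (c := fun t => ρ t / sc t) hzmpos hzm0
      (hcn fun _ => 1)).div hwz hCpos.ne'
    have h2 : (∑ t, ρ t / sc t * if rc t = rmin then 1 * a t rmin else 0) / C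
        = 1 / (rmin : ℝ) := by
      have h3 : C = rmin * ∑ t, ρ t / sc t * if rc t = rmin then 1 * a t rmin else 0 := by
        rw [hC, Finset.mul_sum]
        refine Finset.sum_congr rfl fun t _ => ?_
        split_ifs <;> ring
      rw [div_eq_div_iff hCpos.ne' (by positivity), h3]
      ring
    rw [h2] at h1
    refine h1.congr' ?_
    filter_upwards [hzmpos] with α h
    simp only [AIcc_eq_one_add_cnSum, Pi.div_apply]
    rw [div_div_div_cancel_right₀ h.ne']
  have hv : Tendsto (fun α => y₀ α / w α ^ (1 / ψ)) l (𝓝 (C ^ (1 / (rmin : ℝ)))) :=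
    tendsto_div_rpow_of_saddle (by omega) hψm hCpos hwpos hzpos hw0 hwz
      (hev.mono fun α h => hE4 α h)
  have hv₁ : 0 < C ^ (1 / (rmin : ℝ)) := Real.rpow_pos_of_pos hCpos _
  have hLe : 0 < (L / Real.exp 1) ^ (T / ψ) :=
    Real.rpow_pos_of_pos (div_pos hL (Real.exp_pos 1)) _
  have hu₁ : 0 < x₁ * (L / Real.exp 1) ^ (T / ψ) := mul_pos hx₁pos hLe
  rw [Qdef_eq_sum_tightSum _ _ _ _ _ _ hCpos.le hL.le, ← hψdef] at hx₁ ⊢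
  set v₁ := C ^ (1 / (rmin : ℝ))
  set u₁ := x₁ * (L / Real.exp 1) ^ (T / ψ) with hu₁def
  have hTle : ∀ t i j, b t i j ≠ 0 → T ≤ ((j : ℝ) - ψ) / i := fun t i j h =>
    hT.2 ⟨t, i, j, h, rfl⟩
  obtain ⟨t, i, j, hbt, hTt⟩ := hT.1
  obtain ⟨hi, hj⟩ := hbsupp t i j hbt
  have hj0 : j ≠ 0 := by
    have := (Finset.mem_Icc.1 hj).1
    have := hpv t
    omega
  have hu : Tendsto (fun α => x₀ α * w α ^ (T / ψ)) l (𝓝 u₁) :=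
    tendsto_rescaled hψ hc hbnn hTle hxy hi hj hj0 hbt hTt.symm hw0 hMlim hv hv₁ hu₁.le hE3' hx₁
  have hvn : ∀ (wt : ℕ → ℕ → ℝ) t, Tendsto
      (fun α => vnSum (kv t) (pv t) (qv t) (b t) wt (x₀ α) (y₀ α) / w α) l
      (𝓝 (tightSum (kv t) (pv t) (qv t) (b t) ψ T wt v₁ u₁)) := fun wt t =>
    tendsto_vnSum_div hψ (hTle t) hwpos hw0 hu hv wt
  set κ := ∑ t, lam t / qv t *
    tightSum (kv t) (pv t) (qv t) (b t) ψ T (fun i _ => (i : ℝ)) v₁ u₁ with hκdef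
  have hκ : Tendsto (fun α => α * L / w α) l (𝓝 κ) := by
    refine (tendsto_sum_div_one_add (c := fun t => lam t / qv t) hMlim
      (hvn fun i _ => (i : ℝ))).congr' ?_
    filter_upwards [hE2'] with α h
    rw [h]
  have hκpos : 0 < κ := by
    refine (one_div_pos.2 hD).trans_le (ge_of_tendsto hκ ?_)
    filter_upwards [hwle, hwpos] with α h h'
    rw [div_le_div_iff₀ hD h']
    linarith
  have hVN : Tendsto (fun α =>
      (∑ t, lam t / qv t * Real.log (BIcc kv pv qv b t (x₀ α) (y₀ α))) / w α) l
      (𝓝 ((1 - T * κ) / ψ)) := by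
    have h1 := tendsto_sum_log_div (c := fun t => lam t / qv t) hwpos hw0 (hvn fun _ _ => 1)
    have h2 : ∑ t, lam t / qv t *
        tightSum (kv t) (pv t) (qv t) (b t) ψ T (fun _ _ => 1) v₁ u₁ = (1 - T * κ) / ψ := by
      rw [eq_div_iff hψ.ne', eq_sub_iff_add_eq, hκdef, Finset.mul_sum, Finset.sum_mul,
        ← Finset.sum_add_distrib]
      refine (Finset.sum_congr rfl fun t _ => ?_).trans hx₁
      rw [tightSum_linear]
      ring
    rw [h2] at h1
    simpa only [BIcc_eq_one_add_vnSum] using h1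
  have hfinal := tendsto_growth_rate hL hκpos hu₁
    ((hα.and hxy).mono fun α h => ⟨h.1, h.2.1, h.2.2.2⟩) hw0 hκ hVN hCN hu
  convert hfinal using 2
  · rw [← hcE, ← hdE, mul_div_cancel_left₀ _ hL.ne', mul_div_right_comm]
  · rw [hu₁def, Real.log_mul hx₁pos.ne' hLe.ne', Real.log_rpow (by positivity),
      Real.log_div hL.ne' (Real.exp_pos 1).ne', Real.log_exp]
    have h1 : (1 - T * κ) / ψ + 1 / rmin - 1 = - (T / ψ) * κ := by
      linear_combination hψm
    rw [h1]
    field_simp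
    ring
end
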